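/- A bipartite state ρ_AB on finite-dimensional H_A ⊗ H_B has zero quantum discord (with measurements on B) if and only if there exist a probability distribution {p_j}, density operators ρ_{A|j} on H_A, and an orthonormal family {|λ_j⟩} in H_B diagonalizing ρ_B such that ρ_AB = Σ_j p_j ρ_{A|j} ⊗ |λ_j⟩⟨λ_j|. -/

import Mathlib

open Matrix Kronecker BigOperators ComplexOrder

noncomputable section

/-- von Neumann entropy of a (Hermitian) matrix; 0 if not Hermitian. -/
def vNEntropy {n : Type} [Fintype n] [DecidableEq n] (ρ : Matrix n n ℂ) : ℝ :=
  if h : ρ.IsHermitian then ∑ i, Real.negMulLog (h.eigenvalues i) else 0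

/-- Shannon entropy of a finitely supported probability vector. -/
def shannonEntropy {ι : Type} [Fintype ι] (p : ι → ℝ) : ℝ := ∑ i, Real.negMulLog (p i)

/-- Density operator predicate. -/
def IsDensity {n : Type} [Fintype n] [DecidableEq n] (ρ : Matrix n n ℂ) : Prop :=
  ρ.PosSemidef ∧ ρ.trace = 1

/-- |v⟩⟨w| -/
def ketbra {n : Type} (v w : n → ℂ) : Matrix n n ℂ := fun i j => v i * star (w j)

/-- Orthonormal family. -/
def OrthoFam {ι n : Type} [Fintype n] [DecidableEq ι] (v : ι → n → ℂ) : Prop :=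
  ∀ j k, (∑ i, star (v j i) * v k i) = if j = k then 1 else 0

/-- Partial trace over the first (A) factor. -/
def ptrA {dA dB : Type} [Fintype dA] (ρ : Matrix (dA × dB) (dA × dB) ℂ) : Matrix dB dB ℂ :=
  fun b b' => ∑ a, ρ (a, b) (a, b')

/-- Partial trace over the second (B) factor. -/
def ptrB {dA dB : Type} [Fintype dB] (ρ : Matrix (dA × dB) (dA × dB) ℂ) : Matrix dA dA ℂ :=
  fun a a' => ∑ b, ρ (a, b) (a', b)

/-- Outcome probability for POVM element E on B. -/
def pOf {dA dB : Type} [Fintype dA] [Fintype dB] [DecidableEq dA]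
    (ρ : Matrix (dA × dB) (dA × dB) ℂ) (E : Matrix dB dB ℂ) : ℝ :=
  (((1 : Matrix dA dA ℂ) ⊗ₖ E * ρ).trace).re

/-- Conditional state of A given POVM element E on B. -/
def condState {dA dB : Type} [Fintype dA] [Fintype dB] [DecidableEq dA] [DecidableEq dB]
    (ρ : Matrix (dA × dB) (dA × dB) ℂ) (E : Matrix dB dB ℂ) : Matrix dA dA ℂ :=
  ((pOf ρ E : ℂ))⁻¹ • ptrB ((1 : Matrix dA dA ℂ) ⊗ₖ E * ρ)

/-- Set of measured conditional entropies over rank-1 POVMs on B. -/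
def measuredCondEntropies {dA dB : Type} [Fintype dA] [Fintype dB] [DecidableEq dA] [DecidableEq dB]
    (ρ : Matrix (dA × dB) (dA × dB) ℂ) : Set ℝ :=
  { x | ∃ (m : ℕ) (M : Fin m → Matrix dB dB ℂ),
      (∀ i, (M i).PosSemidef) ∧ (∀ i, (M i).rank ≤ 1) ∧ (∑ i, M i = 1) ∧
      x = ∑ i, pOf ρ (M i) * vNEntropy (condState ρ (M i)) }

/-- Quantum discord with measurements on B. -/
def discord {dA dB : Type} [Fintype dA] [Fintype dB] [DecidableEq dA] [DecidableEq dB]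
    (ρ : Matrix (dA × dB) (dA × dB) ℂ) : ℝ :=
  vNEntropy (ptrA ρ) - vNEntropy ρ + sInf (measuredCondEntropies ρ)

/-- The B-contraction ⟨e_j| ρ |e_k⟩ as operator on A. -/
def bContract {dA dB : Type} [Fintype dB]
    (ρ : Matrix (dA × dB) (dA × dB) ℂ) (u v : dB → ℂ) : Matrix dA dA ℂ :=
  fun a a' => ∑ b, ∑ b', star (u b) * ρ (a, b) (a', b') * v b'

/-- Extended state ρ'_ABC from measuring B in basis e, recorded in C with family f. -/
def extState {dA dB dC : Type} [Fintype dA] [Fintype dB] [Fintype dC]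
    (ρ : Matrix (dA × dB) (dA × dB) ℂ) (e : dB → dB → ℂ) (f : dB → dC → ℂ) :
    Matrix (dA × dB × dC) (dA × dB × dC) ℂ :=
  fun x y => ∑ j, ∑ k,
    bContract ρ (e j) (e k) x.1 y.1 * e j x.2.1 * star (e k y.2.1) * f j x.2.2 * star (f k y.2.2)

/-- Partial trace over C for a tripartite A ⊗ B ⊗ C matrix. -/
def ptrC3 {dA dB dC : Type} [Fintype dC]
    (ρ : Matrix (dA × dB × dC) (dA × dB × dC) ℂ) : Matrix (dA × dB) (dA × dB) ℂ :=
  fun x y => ∑ c, ρ (x.1, x.2, c) (y.1, y.2, c)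

/-- Partial trace over A for a tripartite matrix. -/
def ptrA3 {dA dB dC : Type} [Fintype dA]
    (ρ : Matrix (dA × dB × dC) (dA × dB × dC) ℂ) : Matrix (dB × dC) (dB × dC) ℂ :=
  fun x y => ∑ a, ρ (a, x.1, x.2) (a, y.1, y.2)

/-- Partial trace over both A and C. -/
def ptrAC3 {dA dB dC : Type} [Fintype dA] [Fintype dC]
    (ρ : Matrix (dA × dB × dC) (dA × dB × dC) ℂ) : Matrix dB dB ℂ :=
  fun b b' => ∑ a, ∑ c, ρ (a, b, c) (a, b', c)

set_option linter.unusedSectionVars false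

/-- If `(u, y)` dominates `(v, z)` for every resolvent function `x / (1 + t x)`, then it does so for
the logarithm, with an explicit remainder. -/
theorem sum_log_one_add_sub_le {J L : Type} [Fintype J] [Fintype L] (u y : J → ℝ) (v z : L → ℝ)
    (hy : ∀ j, 0 ≤ y j) (hz : ∀ l, 0 ≤ z l)
    (huy : ∀ j, u j ≠ 0 → 0 < y j) (hvz : ∀ l, v l ≠ 0 → 0 < z l) (hsum : ∑ j, u j = ∑ l, v l)
    (h : ∀ t, 0 ≤ t → ∑ l, v l * (z l / (1 + t * z l)) ≤ ∑ j, u j * (y j / (1 + t * y j)))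
    {T : ℝ} (hT : 0 ≤ T) :
    ∑ j, u j * Real.log (1 + T * y j) - ∑ l, v l * Real.log (1 + T * z l) ≤
      ∑ j, u j * Real.log (y j) - ∑ l, v l * Real.log (z l) := by
  let f : ℝ → ℝ := fun t =>
    ∑ j, u j * Real.log (1 + t * y j) - ∑ l, v l * Real.log (1 + t * z l)
  have hlog : ∀ (c : ℝ), 0 ≤ c → ∀ t, 0 ≤ t →
      HasDerivAt (fun t : ℝ => Real.log (1 + t * c)) (c / (1 + t * c)) t := by
    intro c hc t ht
    have h1 : HasDerivAt (fun t : ℝ => 1 + t * c) c t := by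
      simpa using ((hasDerivAt_id t).mul_const c).const_add 1
    exact h1.log (by positivity)
  have hder : ∀ t, 0 ≤ t → HasDerivAt f
      (∑ j, u j * (y j / (1 + t * y j)) - ∑ l, v l * (z l / (1 + t * z l))) t := by
    intro t ht
    refine HasDerivAt.sub ?_ ?_
    · exact HasDerivAt.fun_sum fun j _ => (hlog _ (hy j) t ht).const_mul _
    · exact HasDerivAt.fun_sum fun l _ => (hlog _ (hz l) t ht).const_mul _
  have hmono : MonotoneOn f (Set.Ici 0) := by
    refine monotoneOn_of_deriv_nonneg (convex_Ici 0)
      (fun t ht => (hder t ht).continuousAt.continuousWithinAt) ?_ ?_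
    · intro t ht
      rw [interior_Ici] at ht
      exact (hder t (le_of_lt ht)).differentiableAt.differentiableWithinAt
    · intro t ht
      rw [interior_Ici] at ht
      rw [(hder t (le_of_lt ht)).deriv]
      linarith [h t (le_of_lt ht)]
  have hlim : ∀ {K : Type} [Fintype K] (w c : K → ℝ), (∀ k, w k ≠ 0 → 0 < c k) →
      Filter.Tendsto (fun t : ℝ => ∑ k, w k * (Real.log (1 + t * c k) - Real.log t)) Filter.atTop
        (nhds (∑ k, w k * Real.log (c k))) := by
    intro K _ w c hwc
    refine tendsto_finsetSum _ fun k _ => ?_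
    by_cases hk : w k = 0
    · simp [hk]
    refine Filter.Tendsto.const_mul _ ?_
    have hc := hwc k hk
    have h1 : Filter.Tendsto (fun t : ℝ => Real.log (t⁻¹ + c k)) Filter.atTop
        (nhds (Real.log (0 + c k))) := by
      refine Filter.Tendsto.log ?_ (by simpa using hc.ne')
      exact tendsto_inv_atTop_zero.add_const _
    rw [zero_add] at h1
    refine h1.congr' ?_
    filter_upwards [Filter.eventually_gt_atTop 0] with t ht
    rw [← Real.log_div (by positivity) ht.ne']
    congr 1
    field_simp
  have hf : Filter.Tendsto f Filter.atTop
      (nhds (∑ j, u j * Real.log (y j) - ∑ l, v l * Real.log (z l))) := by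
    refine ((hlim u y huy).sub (hlim v z hvz)).congr fun t => ?_
    simp only [mul_sub, Finset.sum_sub_distrib, ← Finset.sum_mul, hsum, f]
    ring
  refine ge_of_tendsto hf ?_
  filter_upwards [Filter.eventually_ge_atTop T] with t ht
  exact hmono hT (hT.trans ht) ht

/-- Quadratic form of `sum_log_one_add_sub_le`. -/
theorem mul_sub_sq_mul_le_sum_log {J L : Type} [Fintype J] [Fintype L] (u y : J → ℝ)
    (v z : L → ℝ) (hu : ∀ j, 0 ≤ u j) (hv : ∀ l, 0 ≤ v l)
    (hy : ∀ j, 0 ≤ y j) (hz : ∀ l, 0 ≤ z l)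
    (huy : ∀ j, u j ≠ 0 → 0 < y j) (hvz : ∀ l, v l ≠ 0 → 0 < z l) (hsum : ∑ j, u j = ∑ l, v l)
    (h : ∀ t, 0 ≤ t → ∑ l, v l * (z l / (1 + t * z l)) ≤ ∑ j, u j * (y j / (1 + t * y j)))
    {T : ℝ} (hT : 0 ≤ T) :
    T * (∑ j, u j * y j - ∑ l, v l * z l) - T ^ 2 * ∑ j, u j * y j ^ 2 ≤
      ∑ j, u j * Real.log (y j) - ∑ l, v l * Real.log (z l) := by
  refine le_trans ?_ (sum_log_one_add_sub_le u y v z hy hz huy hvz hsum h hT)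
  have h1 : T * ∑ j, u j * y j - T ^ 2 * ∑ j, u j * y j ^ 2 ≤
      ∑ j, u j * Real.log (1 + T * y j) := by
    rw [Finset.mul_sum, Finset.mul_sum, ← Finset.sum_sub_distrib]
    refine Finset.sum_le_sum fun j _ => ?_
    have hx : 0 ≤ T * y j := mul_nonneg hT (hy j)
    have h2 : T * y j - (T * y j) ^ 2 ≤ Real.log (1 + T * y j) := by
      refine le_trans ?_ (Real.le_log_one_add_of_nonneg hx)
      rw [le_div_iff₀ (by positivity)]
      nlinarith [pow_nonneg hx 3, pow_nonneg hx 2]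
    nlinarith [mul_le_mul_of_nonneg_left h2 (hu j)]
  have h3 : ∑ l, v l * Real.log (1 + T * z l) ≤ T * ∑ l, v l * z l := by
    rw [Finset.mul_sum]
    refine Finset.sum_le_sum fun l _ => ?_
    have hx : 0 ≤ T * z l := mul_nonneg hT (hz l)
    have h2 := Real.log_le_sub_one_of_pos (show 0 < 1 + T * z l by positivity)
    nlinarith [mul_le_mul_of_nonneg_left h2 (hv l)]
  linarith

/-- Spectral decomposition of a positive semidefinite matrix, together with its entropy. -/
theorem exists_spectral {n : Type} [Fintype n] [DecidableEq n] {A : Matrix n n ℂ}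
    (hA : A.PosSemidef) :
    ∃ (U : Matrix n n ℂ) (r : n → ℝ), Uᴴ * U = 1 ∧ U * Uᴴ = 1 ∧ (∀ i, 0 ≤ r i) ∧
      A = U * diagonal (fun i => (r i : ℂ)) * Uᴴ ∧ vNEntropy A = ∑ i, Real.negMulLog (r i) := by
  refine ⟨hA.1.eigenvectorUnitary, hA.1.eigenvalues, ?_, ?_, hA.eigenvalues_nonneg, ?_, ?_⟩
  · exact Unitary.coe_star_mul_self _
  · exact Unitary.coe_mul_star_self _
  · have := hA.1.spectral_theorem
    rw [Unitary.conjStarAlgAut_apply] at this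
    exact this
  · rw [vNEntropy, dif_pos hA.1]

theorem two_mul_re_sub_le {s r t : ℝ} (hs : 0 ≤ s) (hr : 0 ≤ r) (ht : 0 ≤ t) (z k : ℂ)
    (h0 : s = 0 → r = 0 ∨ k = 0) :
    2 * (star z * k).re * r - (s + t * r) * Complex.normSq z ≤
      Complex.normSq k * r * ((r / s) / (1 + t * (r / s))) := by
  rcases hs.eq_or_lt with hs0 | hs0
  · rcases h0 hs0.symm with h | h
    · simp [← hs0, h]
    · subst h
      have : 0 ≤ t * r * Complex.normSq z :=
        mul_nonneg (mul_nonneg ht hr) (Complex.normSq_nonneg z)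
      simp [← hs0]
      linarith
  · have hc : 0 < s + t * r := by positivity
    have h1 : (r / s) / (1 + t * (r / s)) = r / (s + t * r) := by field_simp
    rw [h1, ← mul_div_assoc, le_div_iff₀ hc]
    simp only [Complex.normSq_apply, Complex.mul_re, Complex.star_def, Complex.conj_re,
      Complex.conj_im]
    nlinarith [sq_nonneg (k.re * r - (s + t * r) * z.re), sq_nonneg (k.im * r - (s + t * r) * z.im)]

theorem normSq_mul_sub_mul_le {s r : ℝ} (z k : ℂ) (h0 : s = 0 → r = 0 ∨ k = 0) :
    Complex.normSq (k * r - s * z) ≤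
      s * (Complex.normSq k * r * (r / s) -
        (2 * (star z * k).re * r - s * Complex.normSq z)) := by
  by_cases hs0 : s = 0
  · rcases h0 hs0 with h | h <;> simp [hs0, h]
  · apply le_of_eq
    simp only [Complex.normSq_apply, Complex.mul_re, Complex.star_def, Complex.conj_re,
      Complex.conj_im, Complex.sub_re, Complex.sub_im, Complex.mul_im, Complex.ofReal_re,
      Complex.ofReal_im]
    field_simp
    ring

section Variational
variable {n : Type} [Fintype n] [DecidableEq n]

theorem re_trace_conjTranspose_mul (A B : Matrix n n ℂ) :
    ((Aᴴ * B).trace).re = ∑ j, ∑ k, (star (A j k) * B j k).re := by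
  rw [Finset.sum_comm]
  simp [Matrix.trace, Matrix.mul_apply]

theorem trace_conj_unitary {W : Matrix n n ℂ} (hW : Wᴴ * W = 1) (N : Matrix n n ℂ) :
    (W * N * Wᴴ).trace = N.trace := by
  rw [Matrix.trace_mul_comm, ← Matrix.mul_assoc, hW, Matrix.one_mul]

/-- The functional whose supremum over `X` is the resolvent form of relative entropy, written in
the eigenbases of `ρ` and `σ`. -/
theorem variational_eq_sum {U W : Matrix n n ℂ} (hU : Uᴴ * U = 1) (hU' : U * Uᴴ = 1)
    (hW : Wᴴ * W = 1) (hW' : W * Wᴴ = 1) (r s : n → ℝ) (X : Matrix n n ℂ) (t : ℝ) :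
    2 * ((Xᴴ * (W * diagonal (fun i => (r i : ℂ)) * Wᴴ)).trace).re
      - ((Xᴴ * (U * diagonal (fun i => (s i : ℂ)) * Uᴴ) * X).trace).re
      - t * ((X * (W * diagonal (fun i => (r i : ℂ)) * Wᴴ) * Xᴴ).trace).re
    = ∑ j, ∑ k, (2 * (star ((Uᴴ * X * W) j k) * (Uᴴ * W) j k).re * r k
        - (s j + t * r k) * Complex.normSq ((Uᴴ * X * W) j k)) := by
  set Z := Uᴴ * X * W with hZ
  set K := Uᴴ * W with hK
  set R : Matrix n n ℂ := diagonal (fun i => (r i : ℂ))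
  set S : Matrix n n ℂ := diagonal (fun i => (s i : ℂ))
  have hX : X = U * Z * Wᴴ := by
    rw [hZ]
    calc X = (U * Uᴴ) * X * (W * Wᴴ) := by rw [hU', hW']; simp
      _ = _ := by simp only [Matrix.mul_assoc]
  have hXH : Xᴴ = W * Zᴴ * Uᴴ := by
    rw [hX]; simp [Matrix.mul_assoc]
  have e1 : (Xᴴ * (W * R * Wᴴ)).trace = (Zᴴ * (K * R)).trace := by
    rw [← trace_conj_unitary hW (Zᴴ * (K * R)), hXH, hK]
    simp only [Matrix.mul_assoc]
  have e2 : (Xᴴ * (U * S * Uᴴ) * X).trace = (Zᴴ * (S * Z)).trace := by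
    rw [← trace_conj_unitary hW (Zᴴ * (S * Z)), hXH]
    calc _ = (W * Zᴴ * (Uᴴ * U) * S * (Uᴴ * X)).trace := by simp only [Matrix.mul_assoc]
      _ = _ := by
        rw [hU, hX]
        calc _ = (W * Zᴴ * S * (Uᴴ * U) * Z * Wᴴ).trace := by
              simp only [Matrix.mul_assoc, Matrix.mul_one]
          _ = _ := by rw [hU]; simp only [Matrix.mul_assoc, Matrix.mul_one]
  have e3 : (X * (W * R * Wᴴ) * Xᴴ).trace = (Zᴴ * (Z * R)).trace := by
    rw [Matrix.trace_mul_comm, ← trace_conj_unitary hW (Zᴴ * (Z * R)), hXH]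
    have : Uᴴ * (X * W) = Z := by rw [hZ, Matrix.mul_assoc]
    rw [← this]
    simp only [Matrix.mul_assoc]
  rw [e1, e2, e3, re_trace_conjTranspose_mul, re_trace_conjTranspose_mul,
    re_trace_conjTranspose_mul, Finset.mul_sum, Finset.mul_sum, ← Finset.sum_sub_distrib,
    ← Finset.sum_sub_distrib]
  refine Finset.sum_congr rfl fun j _ => ?_
  rw [Finset.mul_sum, Finset.mul_sum, ← Finset.sum_sub_distrib, ← Finset.sum_sub_distrib]
  refine Finset.sum_congr rfl fun k _ => ?_
  simp only [R, S, Matrix.mul_diagonal, Matrix.diagonal_mul, Complex.normSq_apply, Complex.mul_re,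
    Complex.star_def, Complex.conj_re, Complex.mul_im,
    Complex.conj_im, Complex.ofReal_re, Complex.ofReal_im]
  ring

end Variational

section Povm
variable {dA dB : Type} [Fintype dA] [DecidableEq dA] [Fintype dB] [DecidableEq dB]

theorem exists_eq_conjTranspose_mul_self {n : Type} [Fintype n] [DecidableEq n] {A : Matrix n n ℂ}
    (hA : A.PosSemidef) : ∃ B : Matrix n n ℂ, A = Bᴴ * B := by
  open scoped MatrixOrder in
  obtain ⟨B, hB⟩ := CStarAlgebra.nonneg_iff_eq_star_mul_self.mp hA.nonneg
  exact ⟨B, hB⟩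

theorem re_trace_mul_nonneg {n : Type} [Fintype n] [DecidableEq n] {A B : Matrix n n ℂ}
    (hA : A.PosSemidef) (hB : B.PosSemidef) : 0 ≤ ((A * B).trace).re := by
  obtain ⟨C, rfl⟩ := exists_eq_conjTranspose_mul_self hA
  rw [Matrix.mul_assoc, Matrix.trace_mul_comm]
  exact (Complex.le_def.mp (hB.mul_mul_conjTranspose_same C).trace_nonneg).1

theorem trace_kronecker_one_mul (Z : Matrix dA dA ℂ) (N : Matrix (dA × dB) (dA × dB) ℂ) :
    ((Z ⊗ₖ (1 : Matrix dB dB ℂ)) * N).trace = (Z * ptrB N).trace := by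
  simp only [Matrix.trace, Matrix.diag_apply, Matrix.mul_apply, Fintype.sum_prod_type,
    kronecker_apply, ptrB, Finset.mul_sum]
  refine Finset.sum_congr rfl fun a _ => ?_
  rw [Finset.sum_comm]
  refine Finset.sum_congr rfl fun a' _ => ?_
  simp [Matrix.one_apply]

theorem trace_kronecker_mul (Z : Matrix dA dA ℂ) (E : Matrix dB dB ℂ)
    (N : Matrix (dA × dB) (dA × dB) ℂ) :
    ((Z ⊗ₖ E) * N).trace = (Z * ptrB ((1 : Matrix dA dA ℂ) ⊗ₖ E * N)).trace := by
  rw [← trace_kronecker_one_mul, ← Matrix.mul_assoc, ← Matrix.mul_kronecker_mul, Matrix.mul_one,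
    Matrix.one_mul]

theorem ptrB_one_kronecker_mul_comm (E : Matrix dB dB ℂ) (N : Matrix (dA × dB) (dA × dB) ℂ) :
    ptrB ((1 : Matrix dA dA ℂ) ⊗ₖ E * N) = ptrB (N * ((1 : Matrix dA dA ℂ) ⊗ₖ E)) := by
  ext a a'
  have hl : ptrB ((1 : Matrix dA dA ℂ) ⊗ₖ E * N) a a' = ∑ b, ∑ b', E b b' * N (a, b') (a', b) := by
    simp [ptrB, Matrix.mul_apply, Fintype.sum_prod_type, Matrix.one_apply,
      ite_mul, Finset.sum_ite_irrel]
  have hr : ptrB (N * ((1 : Matrix dA dA ℂ) ⊗ₖ E)) a a' = ∑ b, ∑ b', N (a, b) (a', b') * E b' b := by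
    simp [ptrB, Matrix.mul_apply, Fintype.sum_prod_type, Matrix.one_apply,
      mul_ite, Finset.sum_ite_irrel]
  rw [hl, hr, Finset.sum_comm]
  simp only [mul_comm]

theorem ptrB_posSemidef {N : Matrix (dA × dB) (dA × dB) ℂ} (hN : N.PosSemidef) :
    (ptrB N).PosSemidef := by
  have : ptrB N = ∑ b, N.submatrix (fun a => (a, b)) (fun a => (a, b)) := by
    ext a a'
    simp [ptrB, Matrix.sum_apply]
  rw [this]
  exact Matrix.posSemidef_sum _ fun b _ => hN.submatrix _

theorem ptrA_posSemidef {N : Matrix (dA × dB) (dA × dB) ℂ} (hN : N.PosSemidef) :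
    (ptrA N).PosSemidef := by
  have : ptrA N = ∑ a, N.submatrix (fun b => (a, b)) (fun b => (a, b)) := by
    ext b b'
    simp [ptrA, Matrix.sum_apply]
  rw [this]
  exact Matrix.posSemidef_sum _ fun b _ => hN.submatrix _

theorem trace_ptrB (N : Matrix (dA × dB) (dA × dB) ℂ) : (ptrB N).trace = N.trace := by
  simp [Matrix.trace, ptrB, Fintype.sum_prod_type]

theorem trace_ptrA (N : Matrix (dA × dB) (dA × dB) ℂ) : (ptrA N).trace = N.trace := by
  simp only [Matrix.trace, ptrA, Fintype.sum_prod_type, Matrix.diag_apply]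
  exact Finset.sum_comm

theorem ptrB_one_kronecker_mul_posSemidef {N : Matrix (dA × dB) (dA × dB) ℂ} {E : Matrix dB dB ℂ}
    (hN : N.PosSemidef) (hE : E.PosSemidef) :
    (ptrB ((1 : Matrix dA dA ℂ) ⊗ₖ E * N)).PosSemidef := by
  obtain ⟨B, rfl⟩ := exists_eq_conjTranspose_mul_self hE
  have h : (1 : Matrix dA dA ℂ) ⊗ₖ (Bᴴ * B) =
      ((1 : Matrix dA dA ℂ) ⊗ₖ Bᴴ) * ((1 : Matrix dA dA ℂ) ⊗ₖ B) := by
    rw [← Matrix.mul_kronecker_mul, Matrix.one_mul]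
  have h' : (1 : Matrix dA dA ℂ) ⊗ₖ Bᴴ = ((1 : Matrix dA dA ℂ) ⊗ₖ B)ᴴ := by
    rw [Matrix.conjTranspose_kronecker, Matrix.conjTranspose_one]
  rw [h, Matrix.mul_assoc, ptrB_one_kronecker_mul_comm, h']
  exact ptrB_posSemidef (hN.mul_mul_conjTranspose_same _)

end Povm

section Outcomes
variable {dA dB : Type} [Fintype dA] [DecidableEq dA] [Fintype dB] [DecidableEq dB]

theorem trace_one_kronecker_mul (E : Matrix dB dB ℂ) (N : Matrix (dA × dB) (dA × dB) ℂ) :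
    (((1 : Matrix dA dA ℂ) ⊗ₖ E) * N).trace = (E * ptrA N).trace := by
  simp only [Matrix.trace, Matrix.diag_apply, Matrix.mul_apply, Fintype.sum_prod_type,
    kronecker_apply, ptrA, Finset.mul_sum, Matrix.one_apply, ite_mul, one_mul, zero_mul,
    Finset.sum_ite_irrel, Finset.sum_const_zero, Finset.sum_ite_eq, Finset.mem_univ, if_true]
  rw [Finset.sum_comm]
  refine Finset.sum_congr rfl fun b _ => ?_
  rw [Finset.sum_comm]

theorem ptrB_one_kronecker_mul_one_kronecker (E S : Matrix dB dB ℂ) :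
    ptrB (((1 : Matrix dA dA ℂ) ⊗ₖ E) * ((1 : Matrix dA dA ℂ) ⊗ₖ S)) = (E * S).trace • 1 := by
  rw [← Matrix.mul_kronecker_mul]
  ext a a'
  simp [ptrB, Matrix.trace, Matrix.one_apply]

variable {ρ : Matrix (dA × dB) (dA × dB) ℂ} {E : Matrix dB dB ℂ}

theorem pOf_nonneg (hρ : ρ.PosSemidef) (hE : E.PosSemidef) : 0 ≤ pOf ρ E := by
  rw [pOf, ← trace_ptrB]
  exact (Complex.le_def.mp (ptrB_one_kronecker_mul_posSemidef hρ hE).trace_nonneg).1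

theorem ofReal_pOf (hρ : ρ.PosSemidef) (hE : E.PosSemidef) :
    (pOf ρ E : ℂ) = (ptrB ((1 : Matrix dA dA ℂ) ⊗ₖ E * ρ)).trace := by
  have h := Complex.le_def.mp (ptrB_one_kronecker_mul_posSemidef hρ hE).trace_nonneg
  apply Complex.ext
  · simp [pOf, trace_ptrB]
  · simpa using h.2

theorem trace_mul_ptrA (hρ : ρ.PosSemidef) (hE : E.PosSemidef) :
    (E * ptrA ρ).trace = pOf ρ E := by
  rw [ofReal_pOf hρ hE, trace_ptrB, trace_one_kronecker_mul]

theorem pOf_smul_condState (hρ : ρ.PosSemidef) (hE : E.PosSemidef) :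
    (pOf ρ E : ℂ) • condState ρ E = ptrB ((1 : Matrix dA dA ℂ) ⊗ₖ E * ρ) := by
  by_cases h : (pOf ρ E : ℂ) = 0
  · have := (ptrB_one_kronecker_mul_posSemidef hρ hE).trace_eq_zero_iff.mp
      ((ofReal_pOf hρ hE).symm.trans h)
    rw [h, this, zero_smul]
  · rw [condState, smul_smul, mul_inv_cancel₀ h, one_smul]

theorem condState_posSemidef (hρ : ρ.PosSemidef) (hE : E.PosSemidef) :
    (condState ρ E).PosSemidef := by
  refine (ptrB_one_kronecker_mul_posSemidef hρ hE).smul ?_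
  rw [← Complex.ofReal_inv]
  exact_mod_cast inv_nonneg.mpr (pOf_nonneg hρ hE)

theorem pOf_mul_trace_condState (hρ : ρ.PosSemidef) (hE : E.PosSemidef) :
    (pOf ρ E : ℂ) * (condState ρ E).trace = pOf ρ E := by
  rw [← smul_eq_mul, ← Matrix.trace_smul, pOf_smul_condState hρ hE, ofReal_pOf hρ hE]

theorem sum_pOf {ι : Type} [Fintype ι] (hρ : ρ.trace = 1) {M : ι → Matrix dB dB ℂ}
    (hM : ∑ i, M i = 1) : ∑ i, pOf ρ (M i) = 1 := by
  simp only [pOf, trace_one_kronecker_mul]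
  rw [← Complex.re_sum, ← Matrix.trace_sum, ← Finset.sum_mul, hM, Matrix.one_mul, trace_ptrA, hρ,
    Complex.one_re]

end Outcomes

section Variance
variable {dA dB ι : Type} [Fintype dA] [DecidableEq dA] [Fintype dB] [DecidableEq dB] [Fintype ι]

/-- Operator-valued mean of `Y` under the POVM `M`. -/
def povmMean (M : ι → Matrix dB dB ℂ) (Y : ι → Matrix dA dA ℂ) :
    Matrix (dA × dB) (dA × dB) ℂ :=
  ∑ i, Y i ⊗ₖ M i

/-- Operator-valued variance of `Y` under the POVM `M`. -/
def povmVar (M : ι → Matrix dB dB ℂ) (Y : ι → Matrix dA dA ℂ) :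
    Matrix (dA × dB) (dA × dB) ℂ :=
  ∑ i, (Y i ⊗ₖ (1 : Matrix dB dB ℂ) - povmMean M Y) * ((1 : Matrix dA dA ℂ) ⊗ₖ M i) *
    (Y i ⊗ₖ (1 : Matrix dB dB ℂ) - povmMean M Y)

variable {M : ι → Matrix dB dB ℂ} {Y : ι → Matrix dA dA ℂ}

theorem povmMean_isHermitian (hM : ∀ i, (M i).PosSemidef) (hY : ∀ i, (Y i).IsHermitian) :
    (povmMean M Y).IsHermitian := by
  rw [Matrix.IsHermitian, povmMean, Matrix.conjTranspose_sum]
  refine Finset.sum_congr rfl fun i _ => ?_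
  rw [Matrix.conjTranspose_kronecker, (hY i).eq, (hM i).1.eq]

theorem povmVar_posSemidef (hM : ∀ i, (M i).PosSemidef) (hY : ∀ i, (Y i).IsHermitian) :
    (povmVar M Y).PosSemidef := by
  refine Matrix.posSemidef_sum _ fun i _ => ?_
  have h : (Y i ⊗ₖ (1 : Matrix dB dB ℂ) - povmMean M Y)ᴴ =
      Y i ⊗ₖ (1 : Matrix dB dB ℂ) - povmMean M Y := by
    rw [Matrix.conjTranspose_sub, Matrix.conjTranspose_kronecker, (hY i).eq,
      Matrix.conjTranspose_one, (povmMean_isHermitian hM hY).eq]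
  have := (Matrix.PosSemidef.one (n := dA) (R := ℂ)).kronecker (hM i)
  have h2 := this.mul_mul_conjTranspose_same (Y i ⊗ₖ (1 : Matrix dB dB ℂ) - povmMean M Y)
  rwa [h] at h2

theorem povmVar_eq (hM1 : ∑ i, M i = 1) :
    povmVar M Y = ∑ i, (Y i * Y i) ⊗ₖ M i - povmMean M Y * povmMean M Y := by
  have h1 : ∑ i, (1 : Matrix dA dA ℂ) ⊗ₖ M i = 1 := by
    have : ∑ i, (1 : Matrix dA dA ℂ) ⊗ₖ M i = (1 : Matrix dA dA ℂ) ⊗ₖ ∑ i, M i := by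
      ext x y
      simp [Matrix.sum_apply, Finset.mul_sum]
    rw [this, hM1, Matrix.one_kronecker_one]
  have h2 : ∀ i, (Y i ⊗ₖ (1 : Matrix dB dB ℂ) - povmMean M Y) * ((1 : Matrix dA dA ℂ) ⊗ₖ M i) *
      (Y i ⊗ₖ (1 : Matrix dB dB ℂ) - povmMean M Y) =
      (Y i * Y i) ⊗ₖ M i - (Y i ⊗ₖ M i) * povmMean M Y - povmMean M Y * (Y i ⊗ₖ M i)
        + povmMean M Y * ((1 : Matrix dA dA ℂ) ⊗ₖ M i) * povmMean M Y := by
    intro i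
    have e1 : Y i ⊗ₖ (1 : Matrix dB dB ℂ) * ((1 : Matrix dA dA ℂ) ⊗ₖ M i) = Y i ⊗ₖ M i := by
      rw [← Matrix.mul_kronecker_mul, Matrix.mul_one, Matrix.one_mul]
    have e2 : ((1 : Matrix dA dA ℂ) ⊗ₖ M i) * Y i ⊗ₖ (1 : Matrix dB dB ℂ) = Y i ⊗ₖ M i := by
      rw [← Matrix.mul_kronecker_mul, Matrix.mul_one, Matrix.one_mul]
    have e3 : (Y i ⊗ₖ M i) * Y i ⊗ₖ (1 : Matrix dB dB ℂ) = (Y i * Y i) ⊗ₖ M i := by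
      rw [← Matrix.mul_kronecker_mul, Matrix.mul_one]
    rw [sub_mul, e1, mul_sub, sub_mul, sub_mul, e3, Matrix.mul_assoc (povmMean M Y) _ (Y i ⊗ₖ 1),
      e2]
    abel
  rw [povmVar, Finset.sum_congr rfl fun i _ => h2 i, Finset.sum_add_distrib,
    Finset.sum_sub_distrib, Finset.sum_sub_distrib, ← Finset.sum_mul, ← Finset.mul_sum,
    ← Finset.sum_mul, ← Finset.mul_sum, h1, Matrix.mul_one]
  change _ - povmMean M Y * povmMean M Y - povmMean M Y * povmMean M Y + _ = _
  abel

theorem variational_povmMean {ρ : Matrix (dA × dB) (dA × dB) ℂ} (hρ : ρ.PosSemidef)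
    (hM : ∀ i, (M i).PosSemidef) (hM1 : ∑ i, M i = 1) (hY : ∀ i, (Y i).IsHermitian) (t : ℝ) :
    2 * (((povmMean M Y)ᴴ * ρ).trace).re
      - (((povmMean M Y)ᴴ * ((1 : Matrix dA dA ℂ) ⊗ₖ ptrA ρ) * povmMean M Y).trace).re
      - t * ((povmMean M Y * ρ * (povmMean M Y)ᴴ).trace).re
    = ∑ i, pOf ρ (M i) * (2 * ((Y i * condState ρ (M i)).trace).re - ((Y i * Y i).trace).re
        - t * ((Y i * Y i * condState ρ (M i)).trace).re)
      + ((((1 : Matrix dA dA ℂ) ⊗ₖ ptrA ρ) * povmVar M Y).trace).re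
      + t * ((ρ * povmVar M Y).trace).re := by
  have hsq : povmMean M Y * povmMean M Y = ∑ i, (Y i * Y i) ⊗ₖ M i - povmVar M Y := by
    rw [povmVar_eq hM1]; abel
  have hρi : ∀ (Z : Matrix dA dA ℂ) i, ((Z ⊗ₖ M i * ρ).trace).re =
      pOf ρ (M i) * ((Z * condState ρ (M i)).trace).re := by
    intro Z i
    rw [trace_kronecker_mul, ← pOf_smul_condState hρ (hM i), Matrix.mul_smul, Matrix.trace_smul,
      smul_eq_mul, Complex.re_ofReal_mul]
  have hσi : ∀ (Z : Matrix dA dA ℂ) i,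
      ((Z ⊗ₖ M i * ((1 : Matrix dA dA ℂ) ⊗ₖ ptrA ρ)).trace).re = pOf ρ (M i) * (Z.trace).re := by
    intro Z i
    rw [trace_kronecker_mul, ptrB_one_kronecker_mul_one_kronecker, trace_mul_ptrA hρ (hM i),
      Matrix.mul_smul, Matrix.trace_smul, smul_eq_mul, Complex.re_ofReal_mul, Matrix.mul_one]
  have e1 : (((povmMean M Y) * ρ).trace).re =
      ∑ i, pOf ρ (M i) * ((Y i * condState ρ (M i)).trace).re := by
    rw [povmMean, Finset.sum_mul, Matrix.trace_sum, Complex.re_sum]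
    exact Finset.sum_congr rfl fun i _ => hρi _ i
  have e2 : (((povmMean M Y) * ((1 : Matrix dA dA ℂ) ⊗ₖ ptrA ρ) * povmMean M Y).trace).re =
      ∑ i, pOf ρ (M i) * ((Y i * Y i).trace).re
        - ((((1 : Matrix dA dA ℂ) ⊗ₖ ptrA ρ) * povmVar M Y).trace).re := by
    rw [Matrix.trace_mul_comm, ← Matrix.mul_assoc, hsq, sub_mul, Matrix.trace_sub, Complex.sub_re,
      Finset.sum_mul, Matrix.trace_sum, Complex.re_sum, Matrix.trace_mul_comm (povmVar M Y)]
    congr 1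
    exact Finset.sum_congr rfl fun i _ => hσi _ i
  have e3 : ((povmMean M Y * ρ * povmMean M Y).trace).re =
      ∑ i, pOf ρ (M i) * ((Y i * Y i * condState ρ (M i)).trace).re
        - ((ρ * povmVar M Y).trace).re := by
    rw [Matrix.trace_mul_comm, ← Matrix.mul_assoc, hsq, sub_mul, Matrix.trace_sub, Complex.sub_re,
      Finset.sum_mul, Matrix.trace_sum, Complex.re_sum, Matrix.trace_mul_comm (povmVar M Y)]
    congr 1
    exact Finset.sum_congr rfl fun i _ => hρi _ i
  rw [(povmMean_isHermitian hM hY).eq, e1, e2, e3]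
  simp only [mul_sub, Finset.sum_sub_distrib, Finset.mul_sum]
  simp only [mul_left_comm]
  ring

end Variance

section Diagonal
variable {n : Type} [Fintype n] [DecidableEq n]

theorem conj_diagonal_mul_conj_diagonal {V : Matrix n n ℂ} (hV : Vᴴ * V = 1) (a b : n → ℝ) :
    (V * diagonal (fun i => (a i : ℂ)) * Vᴴ) * (V * diagonal (fun i => (b i : ℂ)) * Vᴴ) =
      V * diagonal (fun i => ((a i * b i : ℝ) : ℂ)) * Vᴴ := by
  calc _ = V * diagonal (fun i => (a i : ℂ)) * (Vᴴ * V) * diagonal (fun i => (b i : ℂ)) * Vᴴ := by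
        simp only [Matrix.mul_assoc]
    _ = _ := by
        rw [hV, Matrix.mul_one, Matrix.mul_assoc V, Matrix.diagonal_mul_diagonal]
        simp only [Complex.ofReal_mul]

theorem re_trace_conj_diagonal {V : Matrix n n ℂ} (hV : Vᴴ * V = 1) (a : n → ℝ) :
    ((V * diagonal (fun i => (a i : ℂ)) * Vᴴ).trace).re = ∑ i, a i := by
  rw [trace_conj_unitary hV, Matrix.trace_diagonal, Complex.re_sum]
  simp

theorem conj_diagonal_isHermitian (V : Matrix n n ℂ) (a : n → ℝ) :
    (V * diagonal (fun i => (a i : ℂ)) * Vᴴ).IsHermitian := by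
  rw [Matrix.IsHermitian, Matrix.conjTranspose_mul, Matrix.conjTranspose_mul,
    Matrix.conjTranspose_conjTranspose, Matrix.diagonal_conjTranspose, Matrix.mul_assoc]
  congr 3
  funext i
  simp

theorem sum_normSq_col {K : Matrix n n ℂ} (hK : Kᴴ * K = 1) (k : n) :
    ∑ j, Complex.normSq (K j k) = 1 := by
  have h := congrArg Complex.re (congrFun (congrFun hK k) k)
  simp only [Matrix.mul_apply, Matrix.conjTranspose_apply, Matrix.one_apply_eq, Complex.re_sum,
    Complex.one_re] at h
  rw [← h]
  refine Finset.sum_congr rfl fun j _ => ?_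
  simp [Complex.normSq_apply]

theorem mul_diagonal_mul_conjTranspose_apply_self (K : Matrix n n ℂ) (r : n → ℝ) (j : n) :
    ((K * diagonal (fun i => (r i : ℂ)) * Kᴴ) j j).re = ∑ k, Complex.normSq (K j k) * r k := by
  rw [Matrix.mul_apply, Complex.re_sum]
  refine Finset.sum_congr rfl fun k _ => ?_
  simp only [Matrix.mul_diagonal, Matrix.conjTranspose_apply, Complex.star_def, Complex.mul_re,
    Complex.mul_im, Complex.ofReal_re, Complex.ofReal_im, Complex.conj_re, Complex.conj_im,
    Complex.normSq_apply]
  ring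

end Diagonal

section Joint
variable {dA dB : Type} [Fintype dA] [DecidableEq dA] [Fintype dB] [DecidableEq dB]

theorem ptrA_one_kronecker_conj (E F : Matrix dB dB ℂ) (N : Matrix (dA × dB) (dA × dB) ℂ) :
    ptrA ((1 : Matrix dA dA ℂ) ⊗ₖ E * N * ((1 : Matrix dA dA ℂ) ⊗ₖ F)) = E * ptrA N * F := by
  ext b b'
  simp only [ptrA, Matrix.mul_apply, Fintype.sum_prod_type, kronecker_apply, Matrix.one_apply,
    ite_mul, one_mul, zero_mul, mul_ite, mul_zero, Finset.sum_ite_irrel, Finset.sum_const_zero,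
    Finset.sum_ite_eq, Finset.sum_ite_eq', Finset.mem_univ, if_true, Finset.sum_mul,
    Finset.mul_sum]
  rw [Finset.sum_comm]
  refine Finset.sum_congr rfl fun c _ => ?_
  rw [Finset.sum_comm]

/-- Joint spectral data of a bipartite state and its marginal: `K` is the overlap matrix of the
eigenbases of `ρ` and `1 ⊗ ρ_B`. -/
theorem exists_joint_spectral {ρ : Matrix (dA × dB) (dA × dB) ℂ} (hρ : IsDensity ρ) :
    ∃ (U W : Matrix (dA × dB) (dA × dB) ℂ) (r : dA × dB → ℝ) (s : dB → ℝ),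
      Uᴴ * U = 1 ∧ U * Uᴴ = 1 ∧ Wᴴ * W = 1 ∧ W * Wᴴ = 1 ∧ (∀ k, 0 ≤ r k) ∧ (∀ l, 0 ≤ s l) ∧
      ρ = W * diagonal (fun i => (r i : ℂ)) * Wᴴ ∧
      (1 : Matrix dA dA ℂ) ⊗ₖ ptrA ρ = U * diagonal (fun i => (s i.2 : ℂ)) * Uᴴ ∧
      (∀ j k, s j.2 = 0 → r k = 0 ∨ (Uᴴ * W) j k = 0) ∧
      ∑ x : (dA × dB) × (dA × dB), Complex.normSq ((Uᴴ * W) x.1 x.2) * r x.2 = 1 ∧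
      ∑ x : (dA × dB) × (dA × dB), Complex.normSq ((Uᴴ * W) x.1 x.2) * r x.2 *
        Real.log (r x.2 / s x.1.2) = vNEntropy (ptrA ρ) - vNEntropy ρ := by
  obtain ⟨W, r, hW, hW', hr, hρW, hHρ⟩ := exists_spectral hρ.1
  obtain ⟨V, s, hV, hV', hs, hρV, hHB⟩ := exists_spectral (ptrA_posSemidef hρ.1)
  have hUH : ((1 : Matrix dA dA ℂ) ⊗ₖ V)ᴴ = (1 : Matrix dA dA ℂ) ⊗ₖ Vᴴ := by
    rw [Matrix.conjTranspose_kronecker, Matrix.conjTranspose_one]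
  set U : Matrix (dA × dB) (dA × dB) ℂ := (1 : Matrix dA dA ℂ) ⊗ₖ V with hUdef
  have hU : Uᴴ * U = 1 := by
    rw [hUH, hUdef, ← Matrix.mul_kronecker_mul, hV, Matrix.one_mul, Matrix.one_kronecker_one]
  have hU' : U * Uᴴ = 1 := by
    rw [hUH, hUdef, ← Matrix.mul_kronecker_mul, hV', Matrix.one_mul, Matrix.one_kronecker_one]
  have hK : (Uᴴ * W)ᴴ * (Uᴴ * W) = 1 := by
    rw [Matrix.conjTranspose_mul, Matrix.conjTranspose_conjTranspose]
    calc _ = Wᴴ * (U * Uᴴ) * W := by simp only [Matrix.mul_assoc]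
      _ = 1 := by rw [hU', Matrix.mul_one, hW]
  have hsum_s : ∀ l, ∑ a, ∑ k, Complex.normSq ((Uᴴ * W) (a, l) k) * r k = s l := by
    intro l
    have h1 : (Uᴴ * W) * diagonal (fun i => (r i : ℂ)) * (Uᴴ * W)ᴴ = Uᴴ * ρ * U := by
      rw [Matrix.conjTranspose_mul, Matrix.conjTranspose_conjTranspose]
      conv_rhs => rw [hρW]
      simp only [Matrix.mul_assoc]
    have h2 : ptrA (Uᴴ * ρ * U) = diagonal (fun i => (s i : ℂ)) := by
      rw [hUH, hUdef, ptrA_one_kronecker_conj, hρV]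
      calc _ = (Vᴴ * V) * diagonal (fun i => (s i : ℂ)) * (Vᴴ * V) := by
            simp only [Matrix.mul_assoc]
        _ = _ := by rw [hV, Matrix.one_mul, Matrix.mul_one]
    have h3 := congrArg Complex.re (congrFun (congrFun h2 l) l)
    rw [Matrix.diagonal_apply_eq, Complex.ofReal_re, ← h1] at h3
    rw [← h3, ptrA, Complex.re_sum]
    refine Finset.sum_congr rfl fun a _ => ?_
    rw [mul_diagonal_mul_conjTranspose_apply_self]
  have h0 : ∀ j k, s j.2 = 0 → r k = 0 ∨ (Uᴴ * W) j k = 0 := by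
    rintro ⟨a, l⟩ k hl
    have h1 := (hsum_s l).trans hl
    have hnn : ∀ a k, 0 ≤ Complex.normSq ((Uᴴ * W) (a, l) k) * r k := fun a k =>
      mul_nonneg (Complex.normSq_nonneg _) (hr k)
    rw [Finset.sum_eq_zero_iff_of_nonneg fun a _ => Finset.sum_nonneg fun k _ => hnn a k] at h1
    have h2 := h1 a (Finset.mem_univ _)
    rw [Finset.sum_eq_zero_iff_of_nonneg fun k _ => hnn a k] at h2
    rcases mul_eq_zero.mp (h2 k (Finset.mem_univ _)) with h | h
    · exact Or.inr (Complex.normSq_eq_zero.mp h)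
    · exact Or.inl h
  have hsum_r : ∀ g : dA × dB → ℝ,
      ∑ x : (dA × dB) × (dA × dB), Complex.normSq ((Uᴴ * W) x.1 x.2) * g x.2 = ∑ k, g k := by
    intro g
    rw [Fintype.sum_prod_type, Finset.sum_comm]
    refine Finset.sum_congr rfl fun k _ => ?_
    dsimp only
    rw [← Finset.sum_mul, sum_normSq_col hK, one_mul]
  refine ⟨U, W, r, s, hU, hU', hW, hW', hr, hs, hρW, ?_, h0, ?_, ?_⟩
  · rw [hUH, hUdef]
    conv_lhs => rw [hρV]
    have : diagonal (fun i : dA × dB => (s i.2 : ℂ)) =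
        (1 : Matrix dA dA ℂ) ⊗ₖ diagonal (fun i => (s i : ℂ)) := by
      rw [← Matrix.diagonal_one, Matrix.diagonal_kronecker_diagonal]
      simp
    rw [this, ← Matrix.mul_kronecker_mul, ← Matrix.mul_kronecker_mul, Matrix.one_mul,
      Matrix.one_mul]
  · rw [hsum_r, ← re_trace_conj_diagonal hW r, ← hρW, hρ.2, Complex.one_re]
  · have h1 : ∀ x : (dA × dB) × (dA × dB), Complex.normSq ((Uᴴ * W) x.1 x.2) * r x.2 *
        Real.log (r x.2 / s x.1.2) = Complex.normSq ((Uᴴ * W) x.1 x.2) * (r x.2 * Real.log (r x.2))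
          - Complex.normSq ((Uᴴ * W) x.1 x.2) * r x.2 * Real.log (s x.1.2) := by
      rintro ⟨j, k⟩
      by_cases hrk : r k = 0
      · simp [hrk]
      by_cases hKjk : (Uᴴ * W) j k = 0
      · simp [hKjk]
      have hsj : s j.2 ≠ 0 := fun h => (h0 j k h).elim hrk hKjk
      simp only
      rw [Real.log_div hrk hsj]
      ring
    rw [Finset.sum_congr rfl fun x _ => h1 x, Finset.sum_sub_distrib,
      hsum_r fun k => r k * Real.log (r k), hHρ, hHB]
    have h2 : ∑ x : (dA × dB) × (dA × dB), Complex.normSq ((Uᴴ * W) x.1 x.2) * r x.2 *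
        Real.log (s x.1.2) = ∑ l, s l * Real.log (s l) := by
      rw [Fintype.sum_prod_type, Fintype.sum_prod_type, Finset.sum_comm]
      refine Finset.sum_congr rfl fun l _ => ?_
      simp only [← Finset.sum_mul]
      rw [hsum_s]
    rw [h2]
    simp only [Real.negMulLog, neg_mul, Finset.sum_neg_distrib]
    ring

end Joint

section Gap
variable {dA dB : Type} [Fintype dA] [DecidableEq dA] [Fintype dB] [DecidableEq dB]

theorem two_mul_re_trace_resolvent {n : Type} [Fintype n] [DecidableEq n] {V : Matrix n n ℂ}
    (hV : Vᴴ * V = 1) {x : n → ℝ} (hx : ∀ a, 0 ≤ x a) {t : ℝ} (ht : 0 ≤ t) {A Y : Matrix n n ℂ}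
    (hA : A = V * diagonal (fun i => (x i : ℂ)) * Vᴴ)
    (hY : Y = V * diagonal (fun i => ((x i / (1 + t * x i) : ℝ) : ℂ)) * Vᴴ) :
    2 * ((Y * A).trace).re - ((Y * Y).trace).re - t * ((Y * Y * A).trace).re =
      ∑ a, x a * (x a / (1 + t * x a)) := by
  rw [hA, hY, conj_diagonal_mul_conj_diagonal hV, conj_diagonal_mul_conj_diagonal hV,
    conj_diagonal_mul_conj_diagonal hV, re_trace_conj_diagonal hV, re_trace_conj_diagonal hV,
    re_trace_conj_diagonal hV, Finset.mul_sum, Finset.mul_sum, ← Finset.sum_sub_distrib,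
    ← Finset.sum_sub_distrib]
  refine Finset.sum_congr rfl fun a _ => ?_
  have h1 : 0 < 1 + t * x a := by have := hx a; positivity
  have h2 : x a / (1 + t * x a) * (1 + t * x a) = x a := div_mul_cancel₀ _ h1.ne'
  linear_combination (-(x a / (1 + t * x a))) * h2

/-- Quantitative nonnegativity of the discord of a POVM: the entropy gap controls the quadratic
gap `G`, which in turn controls the distance of `ρ` to `(1 ⊗ ρ_B) * povmMean` and the variance of
the conditional states. -/
theorem exists_entropy_gap_estimate {ρ : Matrix (dA × dB) (dA × dB) ℂ} (hρ : IsDensity ρ) :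
    ∃ C : ℝ, 0 ≤ C ∧ ∀ (ι : Type) [Fintype ι] (M : ι → Matrix dB dB ℂ),
      (∀ i, (M i).PosSemidef) → ∑ i, M i = 1 → ∃ G : ℝ, 0 ≤ G ∧
        (∀ T : ℝ, 0 ≤ T → T * G - T ^ 2 * C ≤ vNEntropy (ptrA ρ) - vNEntropy ρ
          + ∑ i, pOf ρ (M i) * vNEntropy (condState ρ (M i))) ∧
        ((((1 : Matrix dA dA ℂ) ⊗ₖ ptrA ρ) *
          povmVar M (fun i => condState ρ (M i))).trace).re ≤ G ∧
        ∑ j, ∑ k, Complex.normSq ((ρ - ((1 : Matrix dA dA ℂ) ⊗ₖ ptrA ρ) *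
          povmMean M (fun i => condState ρ (M i))) j k) ≤ C * G := by
  obtain ⟨U, W, r, s, hU, hU', hW, hW', hr, hs, hρW, hσU, h0, hsum1, hent⟩ :=
    exists_joint_spectral hρ
  set K := Uᴴ * W with hK
  set σ := (1 : Matrix dA dA ℂ) ⊗ₖ ptrA ρ with hσ
  have hσpos : σ.PosSemidef := Matrix.PosSemidef.one.kronecker (ptrA_posSemidef hρ.1)
  let u : (dA × dB) × (dA × dB) → ℝ := fun x => Complex.normSq (K x.1 x.2) * r x.2
  let y : (dA × dB) × (dA × dB) → ℝ := fun x => r x.2 / s x.1.2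
  have hu : ∀ x, 0 ≤ u x := fun x => mul_nonneg (Complex.normSq_nonneg _) (hr _)
  have hy : ∀ x, 0 ≤ y x := fun x => div_nonneg (hr _) (hs _)
  have huy : ∀ x, u x ≠ 0 → 0 < y x := by
    intro x hx
    have h1 : Complex.normSq (K x.1 x.2) ≠ 0 := left_ne_zero_of_mul hx
    have h2 : r x.2 ≠ 0 := right_ne_zero_of_mul hx
    have h3 : s x.1.2 ≠ 0 := fun h =>
      (h0 x.1 x.2 h).elim h2 fun h => h1 (Complex.normSq_eq_zero.mpr h)
    exact div_pos ((hr _).lt_of_ne' h2) ((hs _).lt_of_ne' h3)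
  set B := ∑ x, u x * y x ^ 2 with hB
  have hBnn : 0 ≤ B := Finset.sum_nonneg fun x _ => mul_nonneg (hu x) (sq_nonneg _)
  have hSnn : 0 ≤ ∑ l, s l := Finset.sum_nonneg fun l _ => hs l
  refine ⟨B + ∑ l, s l, by positivity, fun ι _ M hM hM1 => ?_⟩
  set x : ι → Matrix dA dA ℂ := fun i => condState ρ (M i) with hxdef
  have hxpos : ∀ i, (x i).PosSemidef := fun i => condState_posSemidef hρ.1 (hM i)
  choose V ξ hV hV' hξ hxV hHx using fun i => exists_spectral (hxpos i)
  have hq : ∀ i, 0 ≤ pOf ρ (M i) := fun i => pOf_nonneg hρ.1 (hM i)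
  let v : ι × dA → ℝ := fun p => pOf ρ (M p.1) * ξ p.1 p.2
  let z : ι × dA → ℝ := fun p => ξ p.1 p.2
  have hv : ∀ p, 0 ≤ v p := fun p => mul_nonneg (hq _) (hξ _ _)
  have hz : ∀ p, 0 ≤ z p := fun p => hξ _ _
  have hvz : ∀ p, v p ≠ 0 → 0 < z p := fun p hp => (hz p).lt_of_ne' (right_ne_zero_of_mul hp)
  have hvsum : ∑ p, v p = 1 := by
    rw [Fintype.sum_prod_type, ← sum_pOf hρ.2 hM1]
    refine Finset.sum_congr rfl fun i _ => ?_
    have h1 := congrArg Complex.re (pOf_mul_trace_condState hρ.1 (hM i))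
    rw [Complex.re_ofReal_mul, Complex.ofReal_re] at h1
    change pOf ρ (M i) * ((x i).trace).re = _ at h1
    rw [hxV i, re_trace_conj_diagonal (hV i), Finset.mul_sum] at h1
    exact h1
  have hvlog : ∑ p, v p * Real.log (z p) = -∑ i, pOf ρ (M i) * vNEntropy (x i) := by
    rw [Fintype.sum_prod_type, ← Finset.sum_neg_distrib]
    refine Finset.sum_congr rfl fun i _ => ?_
    rw [hHx i, Finset.mul_sum, ← Finset.sum_neg_distrib]
    refine Finset.sum_congr rfl fun a _ => ?_
    simp only [Real.negMulLog, v, z]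
    ring
  have hvar : ∀ (Y : ι → Matrix dA dA ℂ) (t : ℝ), (∀ i, (Y i).IsHermitian) →
      ∑ j, ∑ k, (2 * (star ((Uᴴ * povmMean M Y * W) j k) * K j k).re * r k
        - (s j.2 + t * r k) * Complex.normSq ((Uᴴ * povmMean M Y * W) j k)) =
      ∑ i, pOf ρ (M i) * (2 * ((Y i * x i).trace).re - ((Y i * Y i).trace).re
        - t * ((Y i * Y i * x i).trace).re)
      + ((σ * povmVar M Y).trace).re + t * ((ρ * povmVar M Y).trace).re := by
    intro Y t hY
    rw [← variational_povmMean hρ.1 hM hM1 hY t, ← hσ, hσU,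
      ← variational_eq_sum hU hU' hW hW' r (fun j => s j.2) (povmMean M Y) t, ← hρW]
  have hdom : ∀ t, 0 ≤ t → ∑ p, v p * (z p / (1 + t * z p)) ≤ ∑ p, u p * (y p / (1 + t * y p)) := by
    intro t ht
    let Y : ι → Matrix dA dA ℂ := fun i =>
      V i * diagonal (fun a => ((ξ i a / (1 + t * ξ i a) : ℝ) : ℂ)) * (V i)ᴴ
    have hY : ∀ i, (Y i).IsHermitian := fun i =>
      conj_diagonal_isHermitian (V i) fun a => ξ i a / (1 + t * ξ i a)
    have h1 := hvar Y t hY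
    have h2 : ∑ i, pOf ρ (M i) * (2 * ((Y i * x i).trace).re - ((Y i * Y i).trace).re
        - t * ((Y i * Y i * x i).trace).re) = ∑ p, v p * (z p / (1 + t * z p)) := by
      rw [Fintype.sum_prod_type]
      refine Finset.sum_congr rfl fun i _ => ?_
      rw [two_mul_re_trace_resolvent (hV i) (hξ i) ht (hxV i) rfl, Finset.mul_sum]
      refine Finset.sum_congr rfl fun a _ => ?_
      simp only [v, z]
      ring
    have h3 : 0 ≤ ((σ * povmVar M Y).trace).re :=
      re_trace_mul_nonneg hσpos (povmVar_posSemidef hM hY)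
    have h4 : 0 ≤ t * ((ρ * povmVar M Y).trace).re :=
      mul_nonneg ht (re_trace_mul_nonneg hρ.1 (povmVar_posSemidef hM hY))
    have h5 : ∑ j, ∑ k, (2 * (star ((Uᴴ * povmMean M Y * W) j k) * K j k).re * r k
        - (s j.2 + t * r k) * Complex.normSq ((Uᴴ * povmMean M Y * W) j k)) ≤
        ∑ p, u p * (y p / (1 + t * y p)) := by
      conv_rhs => rw [Fintype.sum_prod_type]
      exact Finset.sum_le_sum fun j _ => Finset.sum_le_sum fun k _ =>
        two_mul_re_sub_le (hs _) (hr _) ht _ _ (h0 j k)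
    linarith
  have hx0 := hvar x 0 fun i => (hxpos i).1
  have hvz2 : ∑ i, pOf ρ (M i) * (2 * ((x i * x i).trace).re - ((x i * x i).trace).re
        - 0 * ((x i * x i * x i).trace).re) = ∑ p, v p * z p := by
    rw [Fintype.sum_prod_type]
    refine Finset.sum_congr rfl fun i _ => ?_
    rw [zero_mul, sub_zero, two_mul, add_sub_cancel_right, hxV i,
      conj_diagonal_mul_conj_diagonal (hV i), re_trace_conj_diagonal (hV i), Finset.mul_sum]
    refine Finset.sum_congr rfl fun a _ => ?_
    simp only [v, z]
    ring
  set Z := Uᴴ * povmMean M x * W with hZ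
  have hvarnn : 0 ≤ ((σ * povmVar M x).trace).re :=
    re_trace_mul_nonneg hσpos (povmVar_posSemidef hM fun i => (hxpos i).1)
  let e : dA × dB → dA × dB → ℝ := fun j k => Complex.normSq (K j k) * r k * (r k / s j.2) -
    (2 * (star (Z j k) * K j k).re * r k - s j.2 * Complex.normSq (Z j k))
  have hG : ∑ p, u p * y p - ∑ p, v p * z p =
      ∑ j, ∑ k, e j k + ((σ * povmVar M x).trace).re := by
    rw [hvz2] at hx0
    simp only [e, zero_mul, add_zero, Finset.sum_sub_distrib] at hx0 ⊢
    rw [Fintype.sum_prod_type]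
    linarith
  have henn : ∀ j k, 0 ≤ e j k := by
    intro j k
    have := two_mul_re_sub_le (hs j.2) (hr k) le_rfl (Z j k) (K j k) (h0 j k)
    simp only [zero_mul, add_zero, div_one] at this
    linarith
  have hesum : 0 ≤ ∑ j, ∑ k, e j k :=
    Finset.sum_nonneg fun j _ => Finset.sum_nonneg fun k _ => henn j k
  refine ⟨∑ p, u p * y p - ∑ p, v p * z p, by linarith, fun T hT => ?_, by linarith, ?_⟩
  · have h1 := mul_sub_sq_mul_le_sum_log u y v z hu hv hy hz huy hvz (hsum1.trans hvsum.symm)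
      hdom hT
    rw [hvlog] at h1
    have h2 : ∑ p, u p * Real.log (y p) = vNEntropy (ptrA ρ) - vNEntropy ρ := hent
    rw [h2] at h1
    have h3 : 0 ≤ T ^ 2 * ∑ l, s l := by positivity
    rw [← hB] at h1
    linarith
  · have hN : ρ - σ * povmMean M x =
        U * (K * diagonal (fun i => (r i : ℂ)) - diagonal (fun i => (s i.2 : ℂ)) * Z) * Wᴴ := by
      rw [mul_sub, sub_mul]
      congr 1
      · conv_lhs => rw [hρW]
        rw [hK]
        calc _ = (U * Uᴴ) * W * diagonal (fun i => (r i : ℂ)) * Wᴴ := by rw [hU', Matrix.one_mul]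
          _ = _ := by simp only [Matrix.mul_assoc]
      · rw [hσU, hZ]
        calc _ = U * diagonal (fun i => (s i.2 : ℂ)) * Uᴴ * povmMean M x * (W * Wᴴ) := by
              rw [hW', Matrix.mul_one]
          _ = _ := by simp only [Matrix.mul_assoc]
    have hsq : ∀ A : Matrix (dA × dB) (dA × dB) ℂ,
        ∑ j, ∑ k, Complex.normSq (A j k) = ((Aᴴ * A).trace).re := by
      intro A
      rw [re_trace_conjTranspose_mul]
      refine Finset.sum_congr rfl fun j _ => Finset.sum_congr rfl fun k _ => ?_
      simp [Complex.normSq_apply]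
    set N := K * diagonal (fun i => (r i : ℂ)) - diagonal (fun i => (s i.2 : ℂ)) * Z with hNdef
    have hinv : ((U * N * Wᴴ)ᴴ * (U * N * Wᴴ)).trace = (Nᴴ * N).trace := by
      rw [← trace_conj_unitary hW (Nᴴ * N), Matrix.conjTranspose_mul, Matrix.conjTranspose_mul,
        Matrix.conjTranspose_conjTranspose]
      calc _ = (W * Nᴴ * (Uᴴ * U) * N * Wᴴ).trace := by simp only [Matrix.mul_assoc]
        _ = _ := by rw [hU, Matrix.mul_one]; simp only [Matrix.mul_assoc]
    rw [hN, hsq, hinv, ← hsq]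
    have hle : ∀ j k, Complex.normSq (N j k) ≤ (B + ∑ l, s l) * e j k := by
      intro j k
      have h1 := normSq_mul_sub_mul_le (s := s j.2) (r := r k) (Z j k) (K j k) (h0 j k)
      have h2 : N j k = K j k * r k - s j.2 * Z j k := by
        simp [hNdef, Matrix.sub_apply, Matrix.mul_diagonal, Matrix.diagonal_mul]
      rw [h2]
      refine h1.trans (mul_le_mul_of_nonneg_right ?_ (henn j k))
      have := Finset.single_le_sum (fun l _ => hs l) (Finset.mem_univ j.2)
      linarith
    calc _ ≤ ∑ j, ∑ k, (B + ∑ l, s l) * e j k :=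
          Finset.sum_le_sum fun j _ => Finset.sum_le_sum fun k _ => hle j k
      _ = (B + ∑ l, s l) * ∑ j, ∑ k, e j k := by simp only [Finset.mul_sum]
      _ ≤ _ := mul_le_mul_of_nonneg_left (by linarith) (by positivity)

end Gap

section Blocks
variable {dA dB : Type}

/-- The block of `N` at a pair of indices of the first factor, an operator on the second. -/
def block (N : Matrix (dA × dB) (dA × dB) ℂ) (a a' : dA) : Matrix dB dB ℂ :=
  fun b b' => N (a, b) (a', b')

theorem block_sub (N N' : Matrix (dA × dB) (dA × dB) ℂ) (a a' : dA) :
    block (N - N') a a' = block N a a' - block N' a a' := rfl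

theorem block_conjTranspose (N : Matrix (dA × dB) (dA × dB) ℂ) (a a' : dA) :
    block Nᴴ a a' = (block N a' a)ᴴ := rfl

theorem block_kronecker (X : Matrix dA dA ℂ) (E : Matrix dB dB ℂ) (a a' : dA) :
    block (X ⊗ₖ E) a a' = X a a' • E := rfl

theorem block_sum {ι : Type} [Fintype ι] (N : ι → Matrix (dA × dB) (dA × dB) ℂ) (a a' : dA) :
    block (∑ i, N i) a a' = ∑ i, block (N i) a a' := by
  ext b b'
  simp [block, Matrix.sum_apply]

variable [Fintype dA] [DecidableEq dA] [Fintype dB] [DecidableEq dB]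

theorem block_one_kronecker_mul (E : Matrix dB dB ℂ) (N : Matrix (dA × dB) (dA × dB) ℂ)
    (a a' : dA) : block (((1 : Matrix dA dA ℂ) ⊗ₖ E) * N) a a' = E * block N a a' := by
  ext b b'
  simp [block, Matrix.mul_apply, Fintype.sum_prod_type, Matrix.one_apply, ite_mul,
    Finset.sum_ite_irrel]

theorem block_mul_one_kronecker (E : Matrix dB dB ℂ) (N : Matrix (dA × dB) (dA × dB) ℂ)
    (a a' : dA) : block (N * ((1 : Matrix dA dA ℂ) ⊗ₖ E)) a a' = block N a a' * E := by
  ext b b'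
  simp only [block, Matrix.mul_apply, Fintype.sum_prod_type, kronecker_apply, Matrix.one_apply,
    ite_mul, one_mul, zero_mul, mul_ite, mul_zero]
  rw [Finset.sum_comm]
  simp

theorem norm_conjTranspose_mul_apply_le (P Q : Matrix dB dB ℂ) (s t : dB) :
    ‖(Pᴴ * Q) s t‖ ≤
      (∑ k, ∑ l, Complex.normSq (P k l) + ∑ k, ∑ l, Complex.normSq (Q k l)) / 2 := by
  have hcol : ∀ (X : Matrix dB dB ℂ) k (l : dB),
      Complex.normSq (X k l) ≤ ∑ l, Complex.normSq (X k l) := fun X k l =>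
    Finset.single_le_sum (f := fun l => Complex.normSq (X k l))
      (fun _ _ => Complex.normSq_nonneg _) (Finset.mem_univ l)
  rw [Matrix.mul_apply, ← Finset.sum_add_distrib, Finset.sum_div]
  refine (norm_sum_le _ _).trans (Finset.sum_le_sum fun k _ => ?_)
  rw [norm_mul, Matrix.conjTranspose_apply, norm_star]
  have h1 := hcol P k s
  have h2 := hcol Q k t
  rw [Complex.normSq_eq_norm_sq] at h1 h2
  nlinarith [sq_nonneg (‖P k s‖ - ‖Q k t‖)]

variable {ι : Type} [Fintype ι]

theorem norm_conj_commutator_povmMean_le {M : ι → Matrix dB dB ℂ} {Y : ι → Matrix dA dA ℂ}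
    (hM : ∀ i, (M i).PosSemidef) (hM1 : ∑ i, M i = 1) (hY : ∀ i, (Y i).IsHermitian)
    (R : Matrix dB dB ℂ) (a a' c c' : dA) (s t : dB) :
    ‖(R * (block (povmMean M Y) a a' * block (povmMean M Y) c c'
        - block (povmMean M Y) c c' * block (povmMean M Y) a a') * Rᴴ) s t‖ ≤
      2 * ((((1 : Matrix dA dA ℂ) ⊗ₖ (Rᴴ * R)) * povmVar M Y).trace).re := by
  choose B hB using fun i => exists_eq_conjTranspose_mul_self (hM i)
  set Z := povmMean M Y with hZ
  have hZh : Zᴴ = Z := (povmMean_isHermitian hM hY).eq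
  set D : ι → Matrix (dA × dB) (dA × dB) ℂ := fun i =>
    ((1 : Matrix dA dA ℂ) ⊗ₖ B i) * (Y i ⊗ₖ (1 : Matrix dB dB ℂ) - Z) *
      ((1 : Matrix dA dA ℂ) ⊗ₖ Rᴴ) with hD
  have hDb : ∀ i x y, block (D i) x y = B i * (Y i x y • 1 - block Z x y) * Rᴴ := by
    intro i x y
    rw [hD]
    simp only [block_mul_one_kronecker, block_one_kronecker_mul, block_sub, block_kronecker]
  have hDh : ∀ i, (D i)ᴴ = ((1 : Matrix dA dA ℂ) ⊗ₖ R) * (Y i ⊗ₖ (1 : Matrix dB dB ℂ) - Z) *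
      ((1 : Matrix dA dA ℂ) ⊗ₖ (B i)ᴴ) := by
    intro i
    simp only [hD, Matrix.conjTranspose_mul, Matrix.conjTranspose_kronecker,
      Matrix.conjTranspose_one, Matrix.conjTranspose_conjTranspose, Matrix.conjTranspose_sub,
      (hY i).eq, hZh, Matrix.mul_assoc]
  have htr : ((((1 : Matrix dA dA ℂ) ⊗ₖ (Rᴴ * R)) * povmVar M Y).trace).re =
      ∑ i, ∑ j, ∑ k, Complex.normSq (D i j k) := by
    rw [povmVar, Finset.mul_sum, Matrix.trace_sum, Complex.re_sum]
    refine Finset.sum_congr rfl fun i _ => ?_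
    have h1 : (((D i)ᴴ * D i).trace).re = ∑ j, ∑ k, Complex.normSq (D i j k) := by
      rw [re_trace_conjTranspose_mul]
      refine Finset.sum_congr rfl fun j _ => Finset.sum_congr rfl fun k _ => ?_
      simp [Complex.normSq_apply]
    rw [← h1, hDh]
    have h2 : ((1 : Matrix dA dA ℂ) ⊗ₖ (Rᴴ * R)) =
        ((1 : Matrix dA dA ℂ) ⊗ₖ Rᴴ) * ((1 : Matrix dA dA ℂ) ⊗ₖ R) := by
      rw [← Matrix.mul_kronecker_mul, Matrix.one_mul]
    have h3 : ((1 : Matrix dA dA ℂ) ⊗ₖ M i) =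
        ((1 : Matrix dA dA ℂ) ⊗ₖ (B i)ᴴ) * ((1 : Matrix dA dA ℂ) ⊗ₖ B i) := by
      rw [← Matrix.mul_kronecker_mul, Matrix.one_mul, ← hB]
    rw [h2, h3, Matrix.mul_assoc, Matrix.trace_mul_comm]
    simp only [hD, hZ, Matrix.mul_assoc]
  have hle : ∀ i x y, ∑ k, ∑ l, Complex.normSq (block (D i) x y k l) ≤
      ∑ j, ∑ k, Complex.normSq (D i j k) := by
    intro i x y
    rw [Fintype.sum_prod_type]
    refine le_trans ?_ (Finset.single_le_sum
      (f := fun x => ∑ b, ∑ k, Complex.normSq (D i (x, b) k))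
      (fun _ _ => Finset.sum_nonneg fun _ _ => Finset.sum_nonneg fun _ _ =>
        Complex.normSq_nonneg _) (Finset.mem_univ x))
    refine Finset.sum_le_sum fun b _ => ?_
    rw [Fintype.sum_prod_type]
    exact Finset.single_le_sum
      (f := fun y => ∑ b', Complex.normSq (D i (x, b) (y, b')))
      (fun _ _ => Finset.sum_nonneg fun _ _ => Complex.normSq_nonneg _) (Finset.mem_univ y)
  have hprod : ∀ x x' y y', ∑ i, (block (D i) x' x)ᴴ * block (D i) y y' =
      R * (∑ i, (Y i x x' * Y i y y') • M i - block Z x x' * block Z y y') * Rᴴ := by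
    intro x x' y y'
    have hb : (block Z x' x)ᴴ = block Z x x' := by rw [← block_conjTranspose, hZh]
    have hbs : ∀ x y, block Z x y = ∑ i, Y i x y • M i := by
      intro x y
      simp only [hZ, povmMean, block_sum, block_kronecker]
    have h1 : ∀ i, (block (D i) x' x)ᴴ * block (D i) y y' = R *
        ((Y i x x' * Y i y y') • M i - (Y i x x' • M i) * block Z y y'
          - block Z x x' * (Y i y y' • M i) + block Z x x' * M i * block Z y y') * Rᴴ := by
      intro i
      rw [hDb, hDb, Matrix.conjTranspose_mul, Matrix.conjTranspose_mul,
        Matrix.conjTranspose_conjTranspose, Matrix.conjTranspose_sub, hb,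
        Matrix.conjTranspose_smul, Matrix.conjTranspose_one, (hY i).apply]
      have h2 : R * ((Y i x x' • 1 - block Z x x') * (B i)ᴴ) *
          (B i * (Y i y y' • 1 - block Z y y') * Rᴴ) =
          R * ((Y i x x' • 1 - block Z x x') * ((B i)ᴴ * B i) *
            (Y i y y' • 1 - block Z y y')) * Rᴴ := by
        simp only [Matrix.mul_assoc]
      rw [h2, ← hB]
      congr 2
      simp only [sub_mul, mul_sub, Matrix.smul_mul, Matrix.mul_smul, Matrix.one_mul,
        Matrix.mul_one, smul_smul]
      rw [mul_comm (Y i y y')]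
      abel
    rw [Finset.sum_congr rfl fun i _ => h1 i, ← Finset.sum_mul, ← Finset.mul_sum,
      Finset.sum_add_distrib, Finset.sum_sub_distrib, Finset.sum_sub_distrib, ← Finset.sum_mul,
      ← Finset.mul_sum, ← hbs, ← hbs, ← Finset.sum_mul, ← Finset.mul_sum, hM1, Matrix.mul_one]
    congr 2
    abel
  have hcomm : R * (block Z a a' * block Z c c' - block Z c c' * block Z a a') * Rᴴ =
      ∑ i, (block (D i) c' c)ᴴ * block (D i) a a' - ∑ i, (block (D i) a' a)ᴴ * block (D i) c c' := by
    rw [hprod, hprod, ← sub_mul, ← mul_sub]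
    congr 2
    rw [Finset.sum_congr rfl fun i _ => by rw [mul_comm (Y i c c')]]
    abel
  have hbound : ∀ x x' y y', ‖(∑ i, (block (D i) x' x)ᴴ * block (D i) y y') s t‖ ≤
      ∑ i, ∑ j, ∑ k, Complex.normSq (D i j k) := by
    intro x x' y y'
    rw [Matrix.sum_apply]
    refine (norm_sum_le _ _).trans (Finset.sum_le_sum fun i _ => ?_)
    refine (norm_conjTranspose_mul_apply_le _ _ s t).trans ?_
    linarith [hle i x' x, hle i y y']
  rw [hcomm, Matrix.sub_apply, htr]
  refine (norm_sub_le _ _).trans ?_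
  linarith [hbound c c' a a', hbound a a' c c']

end Blocks

section Commute
open Filter Topology
variable {dA dB : Type} [Fintype dA] [DecidableEq dA] [Fintype dB] [DecidableEq dB]

theorem mem_measuredCondEntropies {ι : Type} [Fintype ι] (ρ : Matrix (dA × dB) (dA × dB) ℂ)
    {M : ι → Matrix dB dB ℂ} (hM : ∀ i, (M i).PosSemidef) (hr : ∀ i, (M i).rank ≤ 1)
    (hM1 : ∑ i, M i = 1) :
    ∑ i, pOf ρ (M i) * vNEntropy (condState ρ (M i)) ∈ measuredCondEntropies ρ := by
  let e := (Fintype.equivFin ι).symm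
  refine ⟨Fintype.card ι, fun i => M (e i), fun i => hM _, fun i => hr _, ?_, ?_⟩
  · rw [← hM1]
    exact Equiv.sum_comp e M
  · exact (Equiv.sum_comp e fun i => pOf ρ (M i) * vNEntropy (condState ρ (M i))).symm

theorem ketbra_eq_vecMulVec {n : Type} (v w : n → ℂ) : ketbra v w = vecMulVec v (star w) := rfl

theorem ketbra_posSemidef {n : Type} [Fintype n] (v : n → ℂ) : (ketbra v v).PosSemidef := by
  rw [ketbra_eq_vecMulVec]
  exact Matrix.posSemidef_vecMulVec_self_star v

theorem rank_ketbra_le {n : Type} [Fintype n] (v w : n → ℂ) : (ketbra v w).rank ≤ 1 := by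
  rw [ketbra_eq_vecMulVec]
  exact Matrix.rank_vecMulVec_le _ _

theorem sum_ketbra_col {n κ : Type} [Fintype κ] [DecidableEq κ] (U : Matrix n κ ℂ) (r : κ → ℂ) :
    ∑ k, r k • ketbra (fun i => U i k) (fun i => U i k) = U * diagonal r * Uᴴ := by
  ext i j
  rw [Matrix.mul_apply]
  simp only [Matrix.sum_apply, Matrix.smul_apply, ketbra, smul_eq_mul, Matrix.mul_diagonal,
    Matrix.conjTranspose_apply]
  exact Finset.sum_congr rfl fun k _ => by ring

theorem measuredCondEntropies_nonempty (ρ : Matrix (dA × dB) (dA × dB) ℂ) :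
    (measuredCondEntropies ρ).Nonempty := by
  refine ⟨_, mem_measuredCondEntropies ρ
    (M := fun k => ketbra (fun i => (1 : Matrix dB dB ℂ) i k) (fun i => (1 : Matrix dB dB ℂ) i k))
    (fun k => ketbra_posSemidef _) (fun k => rank_ketbra_le _ _) ?_⟩
  simpa using sum_ketbra_col (1 : Matrix dB dB ℂ) (fun _ => 1)

theorem exists_seq_of_discord_eq_zero {ρ : Matrix (dA × dB) (dA × dB) ℂ} (hρ : IsDensity ρ)
    (h0 : discord ρ = 0) :
    ∃ Z : ℕ → Matrix (dA × dB) (dA × dB) ℂ, (∀ n, (Z n).IsHermitian) ∧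
      Tendsto (fun n => ((1 : Matrix dA dA ℂ) ⊗ₖ ptrA ρ) * Z n) atTop (𝓝 ρ) ∧
      ∀ a a' c c', Tendsto (fun n => ptrA ρ * (block (Z n) a a' * block (Z n) c c'
        - block (Z n) c c' * block (Z n) a a') * ptrA ρ) atTop (𝓝 0) := by
  obtain ⟨C, hC, hgap⟩ := exists_entropy_gap_estimate hρ
  obtain ⟨R, hR⟩ := exists_eq_conjTranspose_mul_self (ptrA_posSemidef hρ.1)
  have hstep : ∀ n : ℕ, ∃ Z : Matrix (dA × dB) (dA × dB) ℂ, Z.IsHermitian ∧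
      (∑ j, ∑ k, Complex.normSq ((ρ - ((1 : Matrix dA dA ℂ) ⊗ₖ ptrA ρ) * Z) j k)
        ≤ C * ((1 + C) * (1 / ((n : ℝ) + 1)))) ∧
      ∀ a a' c c' s t, ‖(R * (block Z a a' * block Z c c' - block Z c c' * block Z a a') * Rᴴ) s t‖
        ≤ 2 * ((1 + C) * (1 / ((n : ℝ) + 1))) := by
    intro n
    set T : ℝ := 1 / ((n : ℝ) + 1) with hT
    have hTpos : 0 < T := Nat.one_div_pos_of_nat
    obtain ⟨x, ⟨m, M, hM, -, hM1, hx⟩, hlt⟩ :=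
      Real.lt_sInf_add_pos (measuredCondEntropies_nonempty ρ) (pow_pos hTpos 2)
    obtain ⟨G, hG0, hG, hvar, hmean⟩ := hgap (Fin m) M hM hM1
    have hY : ∀ i, (condState ρ (M i)).IsHermitian := fun i => (condState_posSemidef hρ.1 (hM i)).1
    have hGle : G ≤ (1 + C) * T := by
      have h1 := hG T hTpos.le
      rw [← hx] at h1
      rw [discord] at h0
      have h2 : T * G ≤ T * ((1 + C) * T) := by nlinarith
      exact le_of_mul_le_mul_left h2 hTpos
    refine ⟨_, povmMean_isHermitian hM hY, hmean.trans (mul_le_mul_of_nonneg_left hGle hC), ?_⟩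
    intro a a' c c' s t
    refine (norm_conj_commutator_povmMean_le hM hM1 hY R a a' c c' s t).trans ?_
    rw [← hR]
    linarith
  choose Z hZ hmean hcomm using hstep
  have hlim : Tendsto (fun n : ℕ => (1 + C) * (1 / ((n : ℝ) + 1))) atTop (𝓝 0) := by
    simpa using tendsto_one_div_add_atTop_nhds_zero_nat.const_mul (1 + C)
  refine ⟨Z, hZ, ?_, ?_⟩
  · have hentry : ∀ j k, Tendsto (fun n =>
        (ρ - ((1 : Matrix dA dA ℂ) ⊗ₖ ptrA ρ) * Z n) j k) atTop (𝓝 0) := by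
      intro j k
      have hsq : Tendsto (fun n =>
          ‖(ρ - ((1 : Matrix dA dA ℂ) ⊗ₖ ptrA ρ) * Z n) j k‖ ^ 2) atTop (𝓝 0) := by
        refine squeeze_zero (fun n => sq_nonneg _) (fun n => ?_)
          (mul_zero C ▸ hlim.const_mul C)
        refine le_trans ?_ (hmean n)
        rw [← Complex.normSq_eq_norm_sq]
        refine le_trans ?_ (Finset.single_le_sum (fun _ _ => Finset.sum_nonneg fun _ _ =>
          Complex.normSq_nonneg _) (Finset.mem_univ j))
        exact Finset.single_le_sum (f := fun k => Complex.normSq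
          ((ρ - ((1 : Matrix dA dA ℂ) ⊗ₖ ptrA ρ) * Z n) j k))
          (fun _ _ => Complex.normSq_nonneg _) (Finset.mem_univ k)
      rw [tendsto_zero_iff_norm_tendsto_zero]
      simpa using hsq.sqrt
    have hmat : Tendsto (fun n => ρ - ((1 : Matrix dA dA ℂ) ⊗ₖ ptrA ρ) * Z n) atTop (𝓝 0) :=
      tendsto_pi_nhds.mpr fun j => tendsto_pi_nhds.mpr fun k => hentry j k
    simpa using hmat.const_sub ρ
  · intro a a' c c'
    have hmat : Tendsto (fun n => R * (block (Z n) a a' * block (Z n) c c'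
        - block (Z n) c c' * block (Z n) a a') * Rᴴ) atTop (𝓝 0) := by
      refine tendsto_pi_nhds.mpr fun s => tendsto_pi_nhds.mpr fun t => ?_
      exact squeeze_zero_norm (fun n => hcomm n a a' c c' s t) (mul_zero (2 : ℝ) ▸ hlim.const_mul 2)
    have h := (hmat.const_mul Rᴴ).mul_const R
    rw [mul_zero, zero_mul] at h
    refine h.congr fun n => ?_
    rw [hR]
    simp only [Matrix.mul_assoc]

theorem block_commute_of_discord_eq_zero {ρ : Matrix (dA × dB) (dA × dB) ℂ} (hρ : IsDensity ρ)
    (h0 : discord ρ = 0) (a a' c c' : dA) : Commute (block ρ a a') (block ρ c c') := by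
  obtain ⟨Z, hZ, hmean, hcomm⟩ := exists_seq_of_discord_eq_zero hρ h0
  have hcont : ∀ x y, Continuous fun N : Matrix (dA × dB) (dA × dB) ℂ => block N x y := by
    intro x y
    refine continuous_pi fun b => continuous_pi fun b' => ?_
    exact (continuous_apply _).comp (continuous_apply _)
  have hl : ∀ x y, Tendsto (fun n => ptrA ρ * block (Z n) x y) atTop (𝓝 (block ρ x y)) := by
    intro x y
    refine (((hcont x y).tendsto ρ).comp hmean).congr fun n => ?_
    exact block_one_kronecker_mul _ _ _ _
  have hr : ∀ x y, Tendsto (fun n => block (Z n) x y * ptrA ρ) atTop (𝓝 (block ρ x y)) := by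
    intro x y
    have h := ((continuous_id.matrix_conjTranspose).tendsto _).comp (hl y x)
    rw [id, ← block_conjTranspose, hρ.1.1.eq] at h
    refine h.congr fun n => ?_
    simp only [Function.comp, id]
    rw [Matrix.conjTranspose_mul, ← block_conjTranspose, (hZ n).eq, (ptrA_posSemidef hρ.1).1.eq]
  have h := ((hl a a').mul (hr c c')).sub ((hl c c').mul (hr a a'))
  have h' := tendsto_nhds_unique h ((hcomm a a' c c').congr fun n => by
    simp only [mul_sub, sub_mul, Matrix.mul_assoc])
  exact sub_eq_zero.mp h'

end Commute

section JointDiagonalization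
variable {n : Type} [Fintype n] [DecidableEq n]

theorem sum_ketbra_eq_one {lam : Fin (Fintype.card n) → n → ℂ} (h : OrthoFam lam) :
    ∑ j, ketbra (lam j) (lam j) = 1 := by
  let U : Matrix n (Fin (Fintype.card n)) ℂ := fun i j => lam j i
  have h1 : Uᴴ * U = 1 := by
    ext j k
    rw [Matrix.mul_apply, Matrix.one_apply, ← h j k]
    rfl
  rw [Matrix.mul_eq_one_comm_of_equiv (Fintype.equivFin n).symm] at h1
  rw [← h1]
  ext i i'
  rw [Matrix.mul_apply, Matrix.sum_apply]
  rfl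

theorem exists_joint_eigenbasis_of_isHermitian {κ : Type} {H : κ → Matrix n n ℂ}
    (hH : ∀ k, (H k).IsHermitian) (hc : ∀ k l, Commute (H k) (H l)) :
    ∃ lam : Fin (Fintype.card n) → n → ℂ, OrthoFam lam ∧
      ∀ j k, ∃ μ : ℂ, H k *ᵥ lam j = μ • lam j := by
  classical
  let T : κ → Module.End ℂ (EuclideanSpace ℂ n) := fun k => Matrix.toEuclideanLin (H k)
  have hT : ∀ k, (T k).IsSymmetric := fun k => Matrix.isSymmetric_toEuclideanLin_iff.mpr (hH k)
  have hTc : Pairwise (Function.onFun Commute T) := by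
    intro k l _
    refine LinearMap.ext fun v => ?_
    have := hc k l
    apply (WithLp.ofLp_injective 2)
    simp only [T, Module.End.mul_apply, Matrix.ofLp_toLpLin, Matrix.toLin'_apply,
      Matrix.mulVec_mulVec, this.eq]
  have hint := LinearMap.IsSymmetric.directSum_isInternal_of_pairwise_commute hT hTc
  have horth := LinearMap.IsSymmetric.orthogonalFamily_iInf_eigenspaces hT
  have hfin := WellFoundedGT.finite_ne_bot_of_iSupIndep hint.submodule_iSupIndep
  have hint' := DirectSum.isInternal_ne_bot_iff.mpr hint
  have : Fintype {α : κ → ℂ // (⨅ j, Module.End.eigenspace (T j) (α j)) ≠ ⊥} := hfin.fintype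
  have horth' := horth.comp (Subtype.val_injective
    (p := fun α : κ → ℂ => (⨅ j, Module.End.eigenspace (T j) (α j)) ≠ ⊥))
  let b := hint'.subordinateOrthonormalBasis (n := Fintype.card n) (by simp) horth'
  refine ⟨fun j => (b j).ofLp, fun j k => ?_, fun j k => ?_⟩
  · rw [← orthonormal_iff_ite.mp b.orthonormal j k]
    simp [PiLp.inner_apply, mul_comm]
  · have hmem := hint'.subordinateOrthonormalBasis_subordinate (n := Fintype.card n) (by simp) j
      horth'
    have := (Submodule.mem_iInf _).mp hmem k
    rw [Module.End.mem_eigenspace_iff] at this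
    exact ⟨_, by simpa [T] using! congrArg WithLp.ofLp this⟩

theorem exists_joint_eigenbasis {κ : Type} {N : κ → Matrix n n ℂ}
    (hN : ∀ k, ∃ l, (N k)ᴴ = N l) (hc : ∀ k l, Commute (N k) (N l)) :
    ∃ lam : Fin (Fintype.card n) → n → ℂ, OrthoFam lam ∧
      ∀ j k, ∃ μ : ℂ, N k *ᵥ lam j = μ • lam j := by
  choose f hf using hN
  let H : κ × Bool → Matrix n n ℂ := fun k =>
    if k.2 then N k.1 + N (f k.1) else Complex.I • (N k.1 - N (f k.1))
  have hff : ∀ k, N (f (f k)) = N k := fun k => by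
    rw [← hf, ← hf, Matrix.conjTranspose_conjTranspose]
  have hH : ∀ k, (H k).IsHermitian := by
    rintro ⟨k, _ | _⟩
    · simp only [H, Matrix.IsHermitian, Bool.false_eq_true, if_false, Matrix.conjTranspose_smul,
        Matrix.conjTranspose_sub, hf, hff]
      simp [← smul_neg]
    · simp only [H, Matrix.IsHermitian, if_true, Matrix.conjTranspose_add, hf, hff]
      exact add_comm _ _
  have hHc : ∀ k l, Commute (H k) (H l) := by
    have hadd : ∀ k l, Commute (N k + N (f k)) (N l + N (f l)) := fun k l =>
      ((hc _ _).add_left (hc _ _)).add_right ((hc _ _).add_left (hc _ _))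
    have hsub : ∀ k l, Commute (N k - N (f k)) (N l - N (f l)) := fun k l =>
      ((hc _ _).sub_left (hc _ _)).sub_right ((hc _ _).sub_left (hc _ _))
    have hmix : ∀ k l, Commute (N k + N (f k)) (N l - N (f l)) := fun k l =>
      ((hc _ _).add_left (hc _ _)).sub_right ((hc _ _).add_left (hc _ _))
    rintro ⟨k, _ | _⟩ ⟨l, _ | _⟩
    · exact ((hsub k l).smul_left _).smul_right _
    · exact (hmix l k).symm.smul_left _
    · exact (hmix k l).smul_right _
    · exact hadd k l
  obtain ⟨lam, horth, heig⟩ := exists_joint_eigenbasis_of_isHermitian hH hHc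
  refine ⟨lam, horth, fun j k => ?_⟩
  obtain ⟨μ, hμ⟩ := heig j (k, true)
  obtain ⟨ν, hν⟩ := heig j (k, false)
  refine ⟨(1 / 2 : ℂ) * (μ - Complex.I * ν), ?_⟩
  have hNk : N k = (1 / 2 : ℂ) • (H (k, true) - Complex.I • H (k, false)) := by
    simp only [H, if_true, Bool.false_eq_true, if_false, smul_smul, Complex.I_mul_I]
    module
  rw [hNk, Matrix.smul_mulVec, Matrix.sub_mulVec, Matrix.smul_mulVec, hμ, hν]
  module

end JointDiagonalization

section ClassicalQuantum
variable {dA dB : Type} [Fintype dA] [DecidableEq dA] [Fintype dB] [DecidableEq dB]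

theorem ptrB_one_kronecker_mul_apply (E : Matrix dB dB ℂ) (ρ : Matrix (dA × dB) (dA × dB) ℂ)
    (a a' : dA) : ptrB (((1 : Matrix dA dA ℂ) ⊗ₖ E) * ρ) a a' = (E * block ρ a a').trace := by
  rw [← block_one_kronecker_mul]
  rfl

theorem mul_ketbra_self_of_mulVec_eq {n : Type} [Fintype n] {N : Matrix n n ℂ} {v : n → ℂ} {μ : ℂ}
    (h : N *ᵥ v = μ • v) (w : n → ℂ) : N * ketbra v w = μ • ketbra v w := by
  rw [ketbra_eq_vecMulVec, Matrix.mul_vecMulVec, h, Matrix.smul_vecMulVec]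

theorem trace_ketbra {n : Type} [Fintype n] (v w : n → ℂ) :
    (ketbra v w).trace = ∑ i, star (w i) * v i :=
  Finset.sum_congr rfl fun _ _ => mul_comm _ _

theorem exists_cq_of_discord_eq_zero {ρ : Matrix (dA × dB) (dA × dB) ℂ} (hρ : IsDensity ρ)
    (h0 : discord ρ = 0) :
    ∃ (m : ℕ) (p : Fin m → ℝ) (σ : Fin m → Matrix dA dA ℂ) (lam : Fin m → dB → ℂ),
      (∀ j, 0 ≤ p j) ∧ (∑ j, p j = 1) ∧ (∀ j, IsDensity (σ j)) ∧ OrthoFam lam ∧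
      (∀ j, ∃ c : ℝ, (ptrA ρ).mulVec (lam j) = ((c : ℂ)) • lam j) ∧
      ρ = ∑ j, ((p j : ℂ)) • (σ j ⊗ₖ ketbra (lam j) (lam j)) := by
  obtain ⟨lam, horth, heig⟩ := exists_joint_eigenbasis (N := fun x : dA × dA => block ρ x.1 x.2)
    (fun x => ⟨(x.2, x.1), by rw [← block_conjTranspose, hρ.1.1.eq]⟩)
    (fun x y => block_commute_of_discord_eq_zero hρ h0 _ _ _ _)
  have hone := sum_ketbra_eq_one horth
  set K : Fin (Fintype.card dB) → Matrix dB dB ℂ := fun j => ketbra (lam j) (lam j) with hK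
  have hKpsd : ∀ j, (K j).PosSemidef := fun j => ketbra_posSemidef _
  have htr : ∀ j, (K j).trace = 1 := fun j => by rw [hK, trace_ketbra, horth j j, if_pos rfl]
  have hblock : ∀ j a a', block ρ a a' *ᵥ lam j =
      ptrB (((1 : Matrix dA dA ℂ) ⊗ₖ K j) * ρ) a a' • lam j := by
    intro j a a'
    obtain ⟨μ, hμ⟩ := heig j (a, a')
    rw [ptrB_one_kronecker_mul_apply, Matrix.trace_mul_comm,
      mul_ketbra_self_of_mulVec_eq hμ, Matrix.trace_smul, htr, smul_eq_mul, mul_one]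
    exact hμ
  refine ⟨Fintype.card dB, fun j => pOf ρ (K j),
    fun j => if pOf ρ (K j) = 0 then ptrB ρ else condState ρ (K j), lam,
    fun j => pOf_nonneg hρ.1 (hKpsd j), sum_pOf hρ.2 hone, fun j => ?_, horth,
    fun j => ⟨pOf ρ (K j), ?_⟩, ?_⟩
  · dsimp only
    split_ifs with hp
    · exact ⟨ptrB_posSemidef hρ.1, (trace_ptrB ρ).trans hρ.2⟩
    · refine ⟨condState_posSemidef hρ.1 (hKpsd j), ?_⟩
      have := pOf_mul_trace_condState hρ.1 (hKpsd j)
      exact mul_left_cancel₀ (Complex.ofReal_ne_zero.mpr hp) (this.trans (mul_one _).symm)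
  · have hpt : ptrA ρ = ∑ a, block ρ a a := by
      ext b b'
      simp [ptrA, block, Matrix.sum_apply]
    rw [hpt, Matrix.sum_mulVec, Finset.sum_congr rfl fun a _ => hblock j a a, ← Finset.sum_smul,
      ofReal_pOf hρ.1 (hKpsd j)]
    rfl
  · have hσ : ∀ j, (pOf ρ (K j) : ℂ) • ((if pOf ρ (K j) = 0 then ptrB ρ else condState ρ (K j)) ⊗ₖ
        K j) = ptrB (((1 : Matrix dA dA ℂ) ⊗ₖ K j) * ρ) ⊗ₖ K j := by
      intro j
      rw [← pOf_smul_condState hρ.1 (hKpsd j), ← Matrix.smul_kronecker]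
      split_ifs with hp
      · rw [hp, Complex.ofReal_zero, zero_smul, zero_smul]
      · rfl
    rw [Finset.sum_congr rfl fun j _ => hσ j]
    have hb : ∀ a a', block ρ a a' =
        block (∑ j, ptrB (((1 : Matrix dA dA ℂ) ⊗ₖ K j) * ρ) ⊗ₖ K j) a a' := by
      intro a a'
      rw [block_sum]
      conv_lhs => rw [← Matrix.mul_one (block ρ a a'), ← hone, Finset.mul_sum]
      refine Finset.sum_congr rfl fun j _ => ?_
      rw [block_kronecker]
      exact mul_ketbra_self_of_mulVec_eq (hblock j a a') _
    ext ⟨a, b⟩ ⟨a', b'⟩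
    exact congrFun (congrFun (hb a a') b) b'

end ClassicalQuantum

section Entropy
variable {n κ : Type} [Fintype n] [DecidableEq n] [Fintype κ] [DecidableEq κ]

theorem vNEntropy_sum_ketbra {v : κ → n → ℂ} (hv : OrthoFam v) {c : κ → ℝ} {A : Matrix n n ℂ}
    (hA : A.PosSemidef) (hAc : A = ∑ k, (c k : ℂ) • ketbra (v k) (v k)) :
    vNEntropy A = ∑ k, Real.negMulLog (c k) := by
  obtain ⟨U, r, hU, hU', -, hAr, hS⟩ := exists_spectral hA
  set V : Matrix n κ ℂ := fun i k => v k i with hVdef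
  have hV : Vᴴ * V = 1 := by
    ext j k
    rw [Matrix.mul_apply, Matrix.one_apply, ← hv j k]
    rfl
  have hAV : A = V * diagonal (fun k => (c k : ℂ)) * Vᴴ := by
    rw [hAc, ← sum_ketbra_col]
  set W : Matrix n κ ℂ := Uᴴ * V with hW
  have hint : diagonal (fun i => (r i : ℂ)) * W = W * diagonal (fun k => (c k : ℂ)) := by
    have h1 : Uᴴ * A * V = diagonal (fun i => (r i : ℂ)) * W := by
      calc Uᴴ * A * V = (Uᴴ * U) * diagonal (fun i => (r i : ℂ)) * (Uᴴ * V) := by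
            rw [hAr]; simp only [Matrix.mul_assoc]
        _ = _ := by rw [hU, Matrix.one_mul]
    have h2 : Uᴴ * A * V = W * diagonal (fun k => (c k : ℂ)) := by
      calc Uᴴ * A * V = (Uᴴ * V) * diagonal (fun k => (c k : ℂ)) * (Vᴴ * V) := by
            rw [hAV]; simp only [Matrix.mul_assoc]
        _ = _ := by rw [hV, Matrix.mul_one]
    rw [← h1, h2]
  have hWW : Wᴴ * W = 1 := by
    calc Wᴴ * W = Vᴴ * (U * Uᴴ) * V := by
          rw [hW, Matrix.conjTranspose_mul, Matrix.conjTranspose_conjTranspose]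
          simp only [Matrix.mul_assoc]
      _ = 1 := by rw [hU', Matrix.mul_one, hV]
  have hWdW : diagonal (fun i => (r i : ℂ)) * (W * Wᴴ) = diagonal (fun i => (r i : ℂ)) := by
    rw [← Matrix.mul_assoc, hint]
    calc W * diagonal (fun k => (c k : ℂ)) * Wᴴ = Uᴴ * A * U := by
          rw [hAV, hW, Matrix.conjTranspose_mul, Matrix.conjTranspose_conjTranspose]
          simp only [Matrix.mul_assoc]
      _ = (Uᴴ * U) * diagonal (fun i => (r i : ℂ)) * (Uᴴ * U) := by
          rw [hAr]; simp only [Matrix.mul_assoc]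
      _ = _ := by rw [hU, Matrix.one_mul, Matrix.mul_one]
  have hcol : ∀ l, ∑ k, Complex.normSq (W k l) = 1 := by
    intro l
    have h := congrFun (congrFun hWW l) l
    rw [Matrix.mul_apply, Matrix.one_apply_eq] at h
    exact_mod_cast (Finset.sum_congr rfl fun k _ => Complex.normSq_eq_conj_mul_self).trans h
  have hrow : ∀ k, r k ≠ 0 → ∑ l, Complex.normSq (W k l) = 1 := by
    intro k hk
    have h := congrFun (congrFun hWdW k) k
    rw [Matrix.diagonal_mul, Matrix.diagonal_apply_eq, Matrix.mul_apply] at h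
    have h' := mul_left_cancel₀ (Complex.ofReal_ne_zero.mpr hk) (h.trans (mul_one _).symm)
    exact_mod_cast (Finset.sum_congr rfl fun l _ => (Complex.mul_conj (W k l)).symm).trans h'
  have heig : ∀ k l, Complex.normSq (W k l) * Real.negMulLog (c l) =
      Complex.normSq (W k l) * Real.negMulLog (r k) := by
    intro k l
    have h := congrFun (congrFun hint k) l
    rw [Matrix.diagonal_mul, Matrix.mul_diagonal, mul_comm] at h
    by_cases hw : W k l = 0
    · simp [hw]
    · have : r k = c l := by exact_mod_cast mul_left_cancel₀ hw h
      rw [this]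
  calc vNEntropy A = ∑ k, Real.negMulLog (r k) := hS
    _ = ∑ k, ∑ l, Complex.normSq (W k l) * Real.negMulLog (r k) := by
        refine Finset.sum_congr rfl fun k _ => ?_
        rw [← Finset.sum_mul]
        by_cases hk : r k = 0
        · simp [hk]
        · rw [hrow k hk, one_mul]
    _ = ∑ l, ∑ k, Complex.normSq (W k l) * Real.negMulLog (c l) := by
        rw [Finset.sum_comm]
        exact Finset.sum_congr rfl fun l _ => Finset.sum_congr rfl fun k _ => (heig k l).symm
    _ = ∑ l, Real.negMulLog (c l) := by
        refine Finset.sum_congr rfl fun l _ => ?_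
        rw [← Finset.sum_mul, hcol, one_mul]

theorem exists_ketbra_resolution_one_sub {v : κ → n → ℂ} (hv : OrthoFam v) :
    ∃ w : n → n → ℂ, ∑ k, ketbra (v k) (v k) + ∑ i, ketbra (w i) (w i) = 1 := by
  set V : Matrix n κ ℂ := fun i k => v k i with hVdef
  have hV : Vᴴ * V = 1 := by
    ext j k
    rw [Matrix.mul_apply, Matrix.one_apply, ← hv j k]
    rfl
  have hsum : ∑ k, ketbra (v k) (v k) = V * Vᴴ := by
    ext i j
    rw [Matrix.mul_apply, Matrix.sum_apply]
    rfl
  set P : Matrix n n ℂ := 1 - V * Vᴴ with hP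
  have hPP : Pᴴ * P = P := by
    have h : V * Vᴴ * (V * Vᴴ) = V * Vᴴ := by
      rw [Matrix.mul_assoc, ← Matrix.mul_assoc Vᴴ, hV, Matrix.one_mul]
    rw [hP, Matrix.conjTranspose_sub, Matrix.conjTranspose_one, Matrix.conjTranspose_mul,
      Matrix.conjTranspose_conjTranspose, sub_mul, mul_sub, mul_sub, h, Matrix.one_mul,
      Matrix.one_mul, Matrix.mul_one]
    abel
  refine ⟨fun i j => star (P i j), ?_⟩
  have hw : ∑ i, ketbra (fun j => star (P i j)) (fun j => star (P i j)) =
      Pᴴ * P := by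
    ext i j
    rw [Matrix.mul_apply, Matrix.sum_apply]
    refine Finset.sum_congr rfl fun k _ => ?_
    rw [ketbra, star_star, Matrix.conjTranspose_apply]
  rw [hw, hPP, hsum, hP]
  abel

end Entropy

section ZeroDiscord
variable {dA dB : Type} [Fintype dA] [DecidableEq dA] [Fintype dB] [DecidableEq dB]

theorem discord_nonneg {ρ : Matrix (dA × dB) (dA × dB) ℂ} (hρ : IsDensity ρ) : 0 ≤ discord ρ := by
  obtain ⟨C, -, hgap⟩ := exists_entropy_gap_estimate hρ
  have h : vNEntropy ρ - vNEntropy (ptrA ρ) ≤ sInf (measuredCondEntropies ρ) := by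
    refine le_csInf (measuredCondEntropies_nonempty ρ) ?_
    rintro x ⟨m, M, hM, -, hM1, rfl⟩
    obtain ⟨G, -, hG, -⟩ := hgap (Fin m) M hM hM1
    have := hG 0 le_rfl
    linarith
  rw [discord]
  linarith

theorem discord_le {ι : Type} [Fintype ι] {ρ : Matrix (dA × dB) (dA × dB) ℂ} (hρ : IsDensity ρ)
    {M : ι → Matrix dB dB ℂ} (hM : ∀ i, (M i).PosSemidef) (hr : ∀ i, (M i).rank ≤ 1)
    (hM1 : ∑ i, M i = 1) :
    discord ρ ≤ vNEntropy (ptrA ρ) - vNEntropy ρ +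
      ∑ i, pOf ρ (M i) * vNEntropy (condState ρ (M i)) := by
  obtain ⟨C, -, hgap⟩ := exists_entropy_gap_estimate hρ
  have hbdd : BddBelow (measuredCondEntropies ρ) := by
    refine ⟨vNEntropy ρ - vNEntropy (ptrA ρ), ?_⟩
    rintro x ⟨m, M, hM, -, hM1, rfl⟩
    obtain ⟨G, -, hG, -⟩ := hgap (Fin m) M hM hM1
    have := hG 0 le_rfl
    linarith
  have := csInf_le hbdd (mem_measuredCondEntropies ρ hM hr hM1)
  rw [discord]
  linarith

variable {κ : Type} [Fintype κ] [DecidableEq κ]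

theorem vNEntropy_cq {ρ : Matrix (dA × dB) (dA × dB) ℂ} (hρ : IsDensity ρ) {p : κ → ℝ}
    {σ : κ → Matrix dA dA ℂ} {lam : κ → dB → ℂ} (hσ : ∀ j, IsDensity (σ j)) (hlam : OrthoFam lam)
    (h : ρ = ∑ j, (p j : ℂ) • (σ j ⊗ₖ ketbra (lam j) (lam j))) :
    vNEntropy ρ = ∑ j, Real.negMulLog (p j) + ∑ j, p j * vNEntropy (σ j) := by
  choose U r hU hU' hr hσr hS using fun j => exists_spectral (hσ j).1
  have hsum : ∀ j, ∑ k, r j k = 1 := by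
    intro j
    have h1 := (hσ j).2
    rw [hσr j, Matrix.trace_mul_comm, ← Matrix.mul_assoc, hU, Matrix.one_mul,
      Matrix.trace_diagonal] at h1
    exact_mod_cast h1
  let v : κ × dA → dA × dB → ℂ := fun x y => U x.1 y.1 x.2 * lam x.1 y.2
  have hv : OrthoFam v := by
    rintro ⟨j, k⟩ ⟨j', k'⟩
    have h1 : ∑ y, star (v (j, k) y) * v (j', k') y =
        (∑ a, star (U j a k) * U j' a k') * ∑ b, star (lam j b) * lam j' b := by
      rw [Fintype.sum_prod_type, Finset.sum_mul_sum]
      refine Finset.sum_congr rfl fun a _ => Finset.sum_congr rfl fun b _ => ?_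
      simp only [v, star_mul']
      ring
    rw [h1, hlam j j']
    by_cases hj : j = j'
    · subst hj
      have h2 := congrFun (congrFun (hU j) k) k'
      rw [Matrix.mul_apply, Matrix.one_apply] at h2
      simpa using h2
    · simp [hj]
  have hdec : ρ = ∑ x : κ × dA, ((p x.1 * r x.1 x.2 : ℝ) : ℂ) • ketbra (v x) (v x) := by
    rw [h, Fintype.sum_prod_type]
    refine Finset.sum_congr rfl fun j _ => ?_
    ext ⟨a, b⟩ ⟨a', b'⟩
    conv_lhs => rw [hσr j, ← sum_ketbra_col]
    simp only [Matrix.smul_apply, kronecker_apply, Matrix.sum_apply, ketbra, smul_eq_mul,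
      Finset.sum_mul, Finset.mul_sum, v, star_mul', Complex.ofReal_mul]
    exact Finset.sum_congr rfl fun k _ => by ring
  rw [vNEntropy_sum_ketbra hv hρ.1 hdec, Fintype.sum_prod_type, ← Finset.sum_add_distrib]
  refine Finset.sum_congr rfl fun j _ => ?_
  simp only [Real.negMulLog_mul, Finset.sum_add_distrib]
  rw [← Finset.sum_mul, hsum, one_mul, ← Finset.mul_sum, hS]

theorem trace_ketbra_mul_ketbra {lam : κ → dB → ℂ} (hlam : OrthoFam lam) (j k : κ) :
    (ketbra (lam j) (lam j) * ketbra (lam k) (lam k)).trace = if j = k then 1 else 0 := by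
  have h : ketbra (lam j) (lam j) *ᵥ lam k = (if j = k then (1 : ℂ) else 0) • lam j := by
    rw [← hlam j k]
    ext b
    simp only [Matrix.mulVec, dotProduct, ketbra, Pi.smul_apply, smul_eq_mul, Finset.sum_mul]
    exact Finset.sum_congr rfl fun c _ => by ring
  rw [ketbra_eq_vecMulVec (lam k), Matrix.mul_vecMulVec, h, Matrix.smul_vecMulVec,
    ← ketbra_eq_vecMulVec, Matrix.trace_smul, trace_ketbra, hlam k j, smul_eq_mul]
  by_cases hjk : j = k <;> simp [hjk]

theorem ptrB_one_kronecker_ketbra_mul_cq {ρ : Matrix (dA × dB) (dA × dB) ℂ} {p : κ → ℝ}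
    {σ : κ → Matrix dA dA ℂ} {lam : κ → dB → ℂ} (hlam : OrthoFam lam)
    (h : ρ = ∑ j, (p j : ℂ) • (σ j ⊗ₖ ketbra (lam j) (lam j))) (j : κ) :
    ptrB (((1 : Matrix dA dA ℂ) ⊗ₖ ketbra (lam j) (lam j)) * ρ) = (p j : ℂ) • σ j := by
  ext a a'
  have hb : block ρ a a' = ∑ k, ((p k : ℂ) * σ k a a') • ketbra (lam k) (lam k) := by
    rw [h, block_sum]
    refine Finset.sum_congr rfl fun k _ => ?_
    rw [mul_smul]
    rfl
  rw [ptrB_one_kronecker_mul_apply, hb, Finset.mul_sum, Matrix.trace_sum]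
  simp only [Matrix.mul_smul, Matrix.trace_smul, trace_ketbra_mul_ketbra hlam, smul_eq_mul]
  simp

theorem discord_eq_zero_of_cq {ρ : Matrix (dA × dB) (dA × dB) ℂ} (hρ : IsDensity ρ) {p : κ → ℝ}
    {σ : κ → Matrix dA dA ℂ} {lam : κ → dB → ℂ} (hp1 : ∑ j, p j = 1)
    (hσ : ∀ j, IsDensity (σ j)) (hlam : OrthoFam lam)
    (h : ρ = ∑ j, (p j : ℂ) • (σ j ⊗ₖ ketbra (lam j) (lam j))) : discord ρ = 0 := by
  refine le_antisymm ?_ (discord_nonneg hρ)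
  obtain ⟨w, hw⟩ := exists_ketbra_resolution_one_sub hlam
  let u : κ ⊕ dB → dB → ℂ := Sum.elim lam w
  have hM : ∀ i, (ketbra (u i) (u i)).PosSemidef := fun i => ketbra_posSemidef _
  have hM1 : ∑ i, ketbra (u i) (u i) = 1 := by
    rw [Fintype.sum_sum_type]
    exact hw
  have hptr := ptrB_one_kronecker_ketbra_mul_cq hlam h
  have hpOf : ∀ j, pOf ρ (ketbra (lam j) (lam j)) = p j := by
    intro j
    rw [pOf, ← trace_ptrB, hptr, Matrix.trace_smul, (hσ j).2]
    simp
  have hcond : ∀ j, pOf ρ (ketbra (lam j) (lam j)) *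
      vNEntropy (condState ρ (ketbra (lam j) (lam j))) = p j * vNEntropy (σ j) := by
    intro j
    rw [condState, hptr, hpOf]
    by_cases hj : p j = 0
    · simp [hj]
    · rw [smul_smul, inv_mul_cancel₀ (Complex.ofReal_ne_zero.mpr hj), one_smul]
  have hrest : ∀ b, pOf ρ (ketbra (w b) (w b)) = 0 := by
    have h1 := sum_pOf hρ.2 hM1
    rw [Fintype.sum_sum_type] at h1
    simp only [u, Sum.elim_inl, Sum.elim_inr, hpOf, hp1] at h1
    have h2 : ∑ b, pOf ρ (ketbra (w b) (w b)) = 0 := by linarith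
    exact fun b => (Finset.sum_eq_zero_iff_of_nonneg
      (fun b _ => pOf_nonneg hρ.1 (ketbra_posSemidef _))).mp h2 b (Finset.mem_univ b)
  have hB : ptrA ρ = ∑ j, (p j : ℂ) • ketbra (lam j) (lam j) := by
    ext b b'
    rw [ptrA, h]
    simp only [Matrix.sum_apply, Matrix.smul_apply, kronecker_apply, smul_eq_mul]
    rw [Finset.sum_comm]
    refine Finset.sum_congr rfl fun j _ => ?_
    rw [← Finset.mul_sum, ← Finset.sum_mul]
    have h3 : ∑ a, σ j a a = 1 := (hσ j).2
    rw [h3, one_mul]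
  refine (discord_le hρ hM (fun i => rank_ketbra_le _ _) hM1).trans_eq ?_
  rw [vNEntropy_cq hρ hσ hlam h, vNEntropy_sum_ketbra hlam (ptrA_posSemidef hρ.1) hB,
    Fintype.sum_sum_type]
  simp only [u, Sum.elim_inl, Sum.elim_inr, hrest, hcond, zero_mul, Finset.sum_const_zero]
  ring

end ZeroDiscord

theorem zero_discord_iff_cq {dA dB : Type} [Fintype dA] [DecidableEq dA] [Fintype dB] [DecidableEq dB]
    (ρ : Matrix (dA × dB) (dA × dB) ℂ) (hρ : IsDensity ρ) :
    discord ρ = 0 ↔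
      ∃ (m : ℕ) (p : Fin m → ℝ) (σ : Fin m → Matrix dA dA ℂ) (lam : Fin m → dB → ℂ),
        (∀ j, 0 ≤ p j) ∧ (∑ j, p j = 1) ∧ (∀ j, IsDensity (σ j)) ∧ OrthoFam lam ∧
        (∀ j, ∃ c : ℝ, (ptrA ρ).mulVec (lam j) = ((c : ℂ)) • lam j) ∧
        ρ = ∑ j, ((p j : ℂ)) • (σ j ⊗ₖ ketbra (lam j) (lam j)) := by
  refine ⟨exists_cq_of_discord_eq_zero hρ, ?_⟩
  rintro ⟨m, p, σ, lam, -, hp1, hσ, hlam, -, h⟩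
  exact discord_eq_zero_of_cq hρ hp1 hσ hlam h

end
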